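/- Let π be an irreducible ψ-generic representation of the quasi-split non-split group SO_{2l} with normalized Bessel function B_{π,ψ}. Then for every Weyl element w ∈ W(SO_{2l}) that does not support Bessel functions (i.e. w ∉ B(SO_{2l})), every representative ẇ ∈ N_{SO_{2l}}(T) of w, and every g ∈ B_{SO_{2l}}·ẇ·B_{SO_{2l}}, one has B_{π,ψ}(g) = 0. -/

import Mathlib

open scoped MatrixGroups
open Matrix

noncomputable section

namespace ConverseSO

open Classical in
/-- Evaluate a function defined on `G` at a point of `M` through the (typically injective)
map `c : G → M`, extending by zero. -/
def matFun {G M R : Type*} [Zero R] (c : G → M) (φ : G → R) (m : M) : R :=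
  if h : ∃ g, c g = m then φ h.choose else 0

variable (F : Type) [Field F] [Fintype F]

/-- The antidiagonal matrix `J_m`. -/
def Jmat (m : ℕ) : Matrix (Fin m) (Fin m) F :=
  Matrix.of fun i j => if (i : ℕ) + (j : ℕ) + 1 = m then 1 else 0

/-- The middle-block modification `diag(I_{l-1}, [[0,1],[-ρ,0]], I_{l-1})`. -/
def Dmat (l : ℕ) (ρ : F) : Matrix (Fin (2*l)) (Fin (2*l)) F :=
  Matrix.of fun i j =>
    if (i : ℕ) = l - 1 ∧ (j : ℕ) = l then 1
    else if (i : ℕ) = l ∧ (j : ℕ) = l - 1 then -ρ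
    else if i = j ∧ (i : ℕ) ≠ l - 1 ∧ (i : ℕ) ≠ l then 1
    else 0

/-- `J_{2l,ρ}`. -/
def Jrho (l : ℕ) (ρ : F) : Matrix (Fin (2*l)) (Fin (2*l)) F := Dmat F l ρ * Jmat F (2*l)

/-- The matrix-level special orthogonal "set" attached to a matrix `Jm`. -/
def SOset (m : ℕ) (Jm : Matrix (Fin m) (Fin m) F) : Set (Matrix (Fin m) (Fin m) F) :=
  {g | g.det = 1 ∧ gᵀ * Jm * g = Jm}

/-- The special orthogonal group attached to a matrix `Jm`, as a subgroup of `GL`. -/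
def SOgrp (m : ℕ) (Jm : Matrix (Fin m) (Fin m) F) : Subgroup (GL (Fin m) F) where
  carrier := {g | ((g : Matrix (Fin m) (Fin m) F)).det = 1 ∧
    ((g : Matrix (Fin m) (Fin m) F))ᵀ * Jm * ((g : Matrix (Fin m) (Fin m) F)) = Jm}
  one_mem' := ⟨by simp, by simp⟩
  mul_mem' := by
    rintro a b ⟨ha1, ha2⟩ ⟨hb1, hb2⟩
    refine ⟨by rw [Units.val_mul, Matrix.det_mul, ha1, hb1, one_mul], ?_⟩
    have hab : ((a * b : GL (Fin m) F) : Matrix (Fin m) (Fin m) F)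
        = (a : Matrix (Fin m) (Fin m) F) * (b : Matrix (Fin m) (Fin m) F) := Units.val_mul a b
    rw [hab, Matrix.transpose_mul]
    calc (b : Matrix (Fin m) (Fin m) F)ᵀ * (a : Matrix (Fin m) (Fin m) F)ᵀ * Jm *
          ((a : Matrix (Fin m) (Fin m) F) * (b : Matrix (Fin m) (Fin m) F))
        = (b : Matrix (Fin m) (Fin m) F)ᵀ *
            ((a : Matrix (Fin m) (Fin m) F)ᵀ * Jm * (a : Matrix (Fin m) (Fin m) F)) *
            (b : Matrix (Fin m) (Fin m) F) := by
          simp only [mul_assoc]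
      _ = Jm := by rw [ha2, hb2]
  inv_mem' := by
    intro g hg
    obtain ⟨h1, h2⟩ := hg
    have hv1 : ((g⁻¹ : GL (Fin m) F) : Matrix (Fin m) (Fin m) F) * (g : Matrix (Fin m) (Fin m) F)
        = 1 := by rw [← Units.val_mul, inv_mul_cancel, Units.val_one]
    have hv2 : (g : Matrix (Fin m) (Fin m) F) * ((g⁻¹ : GL (Fin m) F) : Matrix (Fin m) (Fin m) F)
        = 1 := by rw [← Units.val_mul, mul_inv_cancel, Units.val_one]
    constructor
    · have hd := congrArg Matrix.det hv1
      rw [Matrix.det_mul, h1, mul_one, Matrix.det_one] at hd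
      exact hd
    · calc ((g⁻¹ : GL (Fin m) F) : Matrix (Fin m) (Fin m) F)ᵀ * Jm *
            ((g⁻¹ : GL (Fin m) F) : Matrix (Fin m) (Fin m) F)
          = ((g⁻¹ : GL (Fin m) F) : Matrix (Fin m) (Fin m) F)ᵀ *
              ((g : Matrix (Fin m) (Fin m) F)ᵀ * Jm * (g : Matrix (Fin m) (Fin m) F)) *
              ((g⁻¹ : GL (Fin m) F) : Matrix (Fin m) (Fin m) F) := by rw [h2]
        _ = ((g : Matrix (Fin m) (Fin m) F) *
              ((g⁻¹ : GL (Fin m) F) : Matrix (Fin m) (Fin m) F))ᵀ * Jm *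
              ((g : Matrix (Fin m) (Fin m) F) *
              ((g⁻¹ : GL (Fin m) F) : Matrix (Fin m) (Fin m) F)) := by
            rw [Matrix.transpose_mul]; simp only [mul_assoc]
        _ = Jm := by rw [hv2]; simp

/-- The quasi-split even special orthogonal group `SO_{2l}` attached to `J_{2l,ρ}`. -/
abbrev SO2l (l : ℕ) (ρ : F) : Subgroup (GL (Fin (2*l)) F) := SOgrp F (2*l) (Jrho F l ρ)

/-- The odd special orthogonal group `SO_{2m+1}` (split form). -/
abbrev SOodd (m : ℕ) : Subgroup (GL (Fin (2*m+1)) F) := SOgrp F (2*m+1) (Jmat F (2*m+1))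

/-- The underlying matrix of an element of a special orthogonal group. -/
def mat {m : ℕ} {Jm : Matrix (Fin m) (Fin m) F} (g : SOgrp F m Jm) :
    Matrix (Fin m) (Fin m) F :=
  ((g : GL (Fin m) F) : Matrix (Fin m) (Fin m) F)

/-- Upper triangular unipotent predicate for matrices. -/
def upUnip {m : ℕ} (M : Matrix (Fin m) (Fin m) F) : Prop :=
  ∀ i j : Fin m, (j : ℕ) ≤ (i : ℕ) → M i j = if i = j then 1 else 0

/-- The upper triangular unipotent subgroup (as a set) of `SO_{2l}`. -/
def USet (l : ℕ) (ρ : F) : Set (SO2l F l ρ) := {u | upUnip F (mat F u)}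

/-- The upper triangular unipotent matrices in `SO_{2m+1}` (matrix level). -/
def UoddMatSet (m : ℕ) : Set (Matrix (Fin (2*m+1)) (Fin (2*m+1)) F) :=
  {g | g ∈ SOset F (2*m+1) (Jmat F (2*m+1)) ∧ upUnip F g}

/-- The generic character of the upper unipotent subgroup of `SO_{2l}`:
`ψ(u_{1,2} + ⋯ + u_{l-2,l-1} + (1/2)·u_{l-1,l+1})` (1-indexed). -/
def psiU (l : ℕ) (ψ : AddChar F ℂ) (M : Matrix (Fin (2*l)) (Fin (2*l)) F) : ℂ :=
  ψ (∑ i : Fin (2*l), ∑ j : Fin (2*l),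
    (if (j : ℕ) = (i : ℕ) + 1 ∧ (i : ℕ) + 3 ≤ l then M i j
     else if (i : ℕ) + 2 = l ∧ (j : ℕ) = l then (2 : F)⁻¹ * M i j else 0))

/-- The sum `u_{1,2} + ⋯ + u_{n-1,n}` for an `n × n` matrix. -/
def glUSum (n : ℕ) (M : Matrix (Fin n) (Fin n) F) : F :=
  ∑ i : Fin n, ∑ j : Fin n, (if (j : ℕ) = (i : ℕ) + 1 then M i j else 0)

/-- The character `ψ_γ` of `N^{l-n}`:
`ψ(Σ_{i=1}^{l-n-1} v_{i,i+1} + (1/2)·v_{l-n-1,l+1})` (1-indexed). -/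
def psiGam (l n : ℕ) (ψ : AddChar F ℂ) (M : Matrix (Fin (2*l)) (Fin (2*l)) F) : ℂ :=
  ψ (∑ i : Fin (2*l), ∑ j : Fin (2*l),
    (if (j : ℕ) = (i : ℕ) + 1 ∧ (i : ℕ) + 2 + n ≤ l then M i j
     else if (i : ℕ) + 2 + n = l ∧ (j : ℕ) = l then (2 : F)⁻¹ * M i j else 0))

/-- Irreducibility of a representation. -/
def IsIrrep {G V : Type*} [Group G] [AddCommGroup V] [Module ℂ V]
    (π : Representation ℂ G V) : Prop :=
  (∃ v : V, v ≠ 0) ∧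
    ∀ W : Submodule ℂ V, (∀ g : G, ∀ v ∈ W, π g v ∈ W) → W = ⊥ ∨ W = ⊤

/-- Block index function determined by a set `C` of cuts (and their mirrors) for `SO_{2l}`. -/
def blkCut (l : ℕ) (C : Finset ℕ) (i : ℕ) : ℕ :=
  (C.filter (fun c => c ≤ i)).card + (C.filter (fun c => 2*l - c ≤ i)).card

/-- The unipotent radical of the standard parabolic subgroup of `SO_{2l}` given by cuts `C`. -/
def cuspUnip (l : ℕ) (ρ : F) (C : Finset ℕ) : Set (SO2l F l ρ) :=
  {g | ∀ i j : Fin (2*l), blkCut l C (j : ℕ) ≤ blkCut l C (i : ℕ) →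
    mat F g i j = if i = j then 1 else 0}

/-- Cuspidality: the full unipotent-radical sums vanish for every proper standard parabolic. -/
def IsCuspidal (l : ℕ) (ρ : F) {V : Type*} [AddCommGroup V] [Module ℂ V]
    (π : Representation ℂ (SO2l F l ρ) V) : Prop :=
  ∀ C : Finset ℕ, C.Nonempty → (∀ c ∈ C, 1 ≤ c ∧ c ≤ l - 1) →
    ∀ v : V, (∑ᶠ u ∈ cuspUnip F l ρ C, π u v) = 0

/-- `Γ` is a (nonzero) `ψ`-Whittaker functional for `π`. -/
def IsWhittaker (l : ℕ) (ρ : F) (ψ : AddChar F ℂ) {V : Type*} [AddCommGroup V] [Module ℂ V]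
    (π : Representation ℂ (SO2l F l ρ) V) (Γ : V →ₗ[ℂ] ℂ) : Prop :=
  Γ ≠ 0 ∧ ∀ u ∈ USet F l ρ, ∀ v : V, Γ (π u v) = psiU F l ψ (mat F u) * Γ v

/-- `v₀` is a Whittaker vector with `Γ v₀ ≠ 0`. -/
def IsWhitVec (l : ℕ) (ρ : F) (ψ : AddChar F ℂ) {V : Type*} [AddCommGroup V] [Module ℂ V]
    (π : Representation ℂ (SO2l F l ρ) V) (Γ : V →ₗ[ℂ] ℂ) (v₀ : V) : Prop :=
  Γ v₀ ≠ 0 ∧ ∀ u ∈ USet F l ρ, π u v₀ = psiU F l ψ (mat F u) • v₀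

/-- The normalized Bessel function attached to the Whittaker data `(Γ, v₀)`. -/
def Bessel (l : ℕ) (ρ : F) {V : Type*} [AddCommGroup V] [Module ℂ V]
    (π : Representation ℂ (SO2l F l ρ) V) (Γ : V →ₗ[ℂ] ℂ) (v₀ : V) :
    SO2l F l ρ → ℂ :=
  fun g => Γ (π g v₀) / Γ v₀

/-- Equality of central characters. -/
def SameCentralChar (l : ℕ) (ρ : F) {V V' : Type*} [AddCommGroup V] [Module ℂ V]
    [AddCommGroup V'] [Module ℂ V'] (π : Representation ℂ (SO2l F l ρ) V)
    (π' : Representation ℂ (SO2l F l ρ) V') : Prop :=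
  ∃ ω : ℂ, (∀ g : SO2l F l ρ, mat F g = -1 → ∀ v : V, π g v = ω • v) ∧
    (∀ g : SO2l F l ρ, mat F g = -1 → ∀ v' : V', π' g v' = ω • v')
/-- `a^* = J_n · (a⁻¹)ᵀ · J_n`. -/
def aStar (n : ℕ) (a : Matrix (Fin n) (Fin n) F) : Matrix (Fin n) (Fin n) F :=
  Jmat F n * (a⁻¹)ᵀ * Jmat F n

/-- The permutation matrix of `σ`. -/
def permMat (n : ℕ) (σ : Equiv.Perm (Fin n)) : Matrix (Fin n) (Fin n) F :=
  Matrix.of fun i j => if σ j = i then 1 else 0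

/-- `t_n(a) = diag(a, I_{2l-2n}, a^*)` inside `2l × 2l` matrices. -/
def tnMat (l n : ℕ) (a : Matrix (Fin n) (Fin n) F) : Matrix (Fin (2*l)) (Fin (2*l)) F :=
  Matrix.of fun i j =>
    if hi : (i : ℕ) < n then (if hj : (j : ℕ) < n then a ⟨i, hi⟩ ⟨j, hj⟩ else 0)
    else if hi2 : (i : ℕ) < 2*l - n then (if i = j then 1 else 0)
    else if hj2 : 2*l - n ≤ (j : ℕ) then
      aStar F n a ⟨(i : ℕ) - (2*l - n), by have := i.isLt; omega⟩
        ⟨(j : ℕ) - (2*l - n), by have := j.isLt; omega⟩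
    else 0

/-- The Weyl representative `w̃_n` of `SO_{2l}` as a block matrix. -/
def wTildeMat (l n : ℕ) : Matrix (Fin (2*l)) (Fin (2*l)) F :=
  Matrix.of fun i j =>
    if (i : ℕ) < n then (if (j : ℕ) = (i : ℕ) + (2*l - n) then 1 else 0)
    else if (i : ℕ) < l - 1 then (if i = j then 1 else 0)
    else if (i : ℕ) = l - 1 then (if i = j then (-1)^n else 0)
    else if (i : ℕ) < 2*l - n then (if i = j then 1 else 0)
    else (if (j : ℕ) + (2*l - n) = (i : ℕ) then 1 else 0)

/-- The torus matrix `diag(t_1,…,t_{l-1}, [[a,bρ],[b,a]], t_{l-1}⁻¹,…,t_1⁻¹)`. -/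
def torusMat (l : ℕ) (ρ : F) (tv : ℕ → Fˣ) (a b : F) :
    Matrix (Fin (2*l)) (Fin (2*l)) F :=
  Matrix.of fun i j =>
    if (i : ℕ) < l - 1 then (if i = j then (tv (i : ℕ) : F) else 0)
    else if (i : ℕ) = l - 1 then
      (if (j : ℕ) = l - 1 then a else if (j : ℕ) = l then b * ρ else 0)
    else if (i : ℕ) = l then
      (if (j : ℕ) = l - 1 then b else if (j : ℕ) = l then a else 0)
    else (if i = j then ((tv (2*l - 1 - (i : ℕ)))⁻¹ : F) else 0)

/-- The outer element `c = diag(I_{l-1}, 1, -1, I_{l-1})`. -/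
def cMat (l : ℕ) : Matrix (Fin (2*l)) (Fin (2*l)) F :=
  Matrix.of fun i j => if i = j then (if (i : ℕ) = l then -1 else 1) else 0

/-- The torus element `t̃ = diag(I_{l-1}, -1, -1, I_{l-1})`. -/
def tTildeMat (l : ℕ) : Matrix (Fin (2*l)) (Fin (2*l)) F :=
  Matrix.of fun i j =>
    if i = j then (if (i : ℕ) = l - 1 ∨ (i : ℕ) = l then -1 else 1) else 0

/-- `l_n(a) = diag(a, 1, a^*)` inside `(2n+1) × (2n+1)` matrices. -/
def lnMat (n : ℕ) (a : Matrix (Fin n) (Fin n) F) :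
    Matrix (Fin (2*n+1)) (Fin (2*n+1)) F :=
  Matrix.of fun i j =>
    if hi : (i : ℕ) < n then (if hj : (j : ℕ) < n then a ⟨i, hi⟩ ⟨j, hj⟩ else 0)
    else if hi2 : (i : ℕ) = n then (if i = j then 1 else 0)
    else if hj2 : n + 1 ≤ (j : ℕ) then
      aStar F n a ⟨(i : ℕ) - (n+1), by have := i.isLt; omega⟩
        ⟨(j : ℕ) - (n+1), by have := j.isLt; omega⟩
    else 0

/-- The Weyl element `w_n` of `SO_{2n+1}` with block rows `(0,0,I_n)`, `(0,(-1)^n,0)`, `(I_n,0,0)`. -/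
def wnOddMat (n : ℕ) : Matrix (Fin (2*n+1)) (Fin (2*n+1)) F :=
  Matrix.of fun i j =>
    if (i : ℕ) < n then (if (j : ℕ) = (i : ℕ) + n + 1 then 1 else 0)
    else if (i : ℕ) = n then (if i = j then (-1)^n else 0)
    else (if (j : ℕ) + n + 1 = (i : ℕ) then 1 else 0)

/-- `d_n = diag(-1, 1, …, (-1)^n)`. -/
def dnMat (n : ℕ) : Matrix (Fin n) (Fin n) F :=
  Matrix.of fun i j => if i = j then (-1)^((i : ℕ) + 1) else 0

/-- The block permutation matrix `w^{l,n}` of `SO_{2l}`. -/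
def wlnMat (l n : ℕ) : Matrix (Fin (2*l)) (Fin (2*l)) F :=
  Matrix.of fun i j =>
    if (i : ℕ) < n then (if (j : ℕ) = (i : ℕ) + (l - n - 1) then 1 else 0)
    else if (i : ℕ) < l - 1 then (if (j : ℕ) + n = (i : ℕ) then 1 else 0)
    else if (i : ℕ) < l + 1 then (if i = j then 1 else 0)
    else if (i : ℕ) < 2*l - n then (if (j : ℕ) = (i : ℕ) + n then 1 else 0)
    else (if (j : ℕ) + (l - n - 1) = (i : ℕ) then 1 else 0)

/-- `w_{l,l} = diag(γ·I_l, 1, γ⁻¹·I_l)` with `γ = ρ/2`. -/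
def wllMat (l : ℕ) (ρ : F) : Matrix (Fin (2*l+1)) (Fin (2*l+1)) F :=
  Matrix.of fun i j =>
    if i = j then
      (if (i : ℕ) < l then ρ/2 else if (i : ℕ) = l then 1 else (ρ/2)⁻¹)
    else 0

/-- The conjugating matrix `M` for the embedding of `SO_{2l}` into `SO_{2l+1}`. -/
def Mtop (l : ℕ) (ρ : F) : Matrix (Fin (2*l+1)) (Fin (2*l+1)) F :=
  Matrix.of fun i j =>
    if (i : ℕ) + 2 = l + 1 then (if (j : ℕ) = l then 1 else 0)
    else if (i : ℕ) = l then
      (if (j : ℕ) + 2 = l + 1 then (2 : F)⁻¹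
       else if (j : ℕ) = l + 1 then (2 * (ρ/2))⁻¹ else 0)
    else if (i : ℕ) = l + 1 then
      (if (j : ℕ) + 2 = l + 1 then (2 : F)⁻¹
       else if (j : ℕ) = l + 1 then -(2 * (ρ/2))⁻¹ else 0)
    else if i = j then 1 else 0

/-- Insert a trivial `(l+1)`-st row and column (1-indexed) into a `2l × 2l` matrix. -/
def insTop (l : ℕ) (g : Matrix (Fin (2*l)) (Fin (2*l)) F) :
    Matrix (Fin (2*l+1)) (Fin (2*l+1)) F :=
  Matrix.of fun i j =>
    if hi : (i : ℕ) = l then (if (j : ℕ) = l then 1 else 0)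
    else if hj : (j : ℕ) = l then 0
    else
      g ⟨if (i : ℕ) < l then (i : ℕ) else (i : ℕ) - 1, by have := i.isLt; split <;> omega⟩
        ⟨if (j : ℕ) < l then (j : ℕ) else (j : ℕ) - 1, by have := j.isLt; split <;> omega⟩

/-- The embedding of `SO_{2l}` into `SO_{2l+1}` at the matrix level. -/
def embTop (l : ℕ) (ρ : F) (g : Matrix (Fin (2*l)) (Fin (2*l)) F) :
    Matrix (Fin (2*l+1)) (Fin (2*l+1)) F :=
  (Mtop F l ρ)⁻¹ * insTop F l g * Mtop F l ρ

/-- The conjugating matrix `M = diag(I_n, [[0,2],[1,0]], I_n)` (size `2n+2`). -/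
def Mlow (n : ℕ) : Matrix (Fin (2*n+2)) (Fin (2*n+2)) F :=
  Matrix.of fun i j =>
    if (i : ℕ) = n then (if (j : ℕ) = n + 1 then 2 else 0)
    else if (i : ℕ) = n + 1 then (if (j : ℕ) = n then 1 else 0)
    else if i = j then 1 else 0

/-- Insert a trivial `(n+2)`-nd row and column (1-indexed) into a `(2n+1) × (2n+1)` matrix. -/
def insLow (n : ℕ) (g : Matrix (Fin (2*n+1)) (Fin (2*n+1)) F) :
    Matrix (Fin (2*n+2)) (Fin (2*n+2)) F :=
  Matrix.of fun i j =>
    if hi : (i : ℕ) = n + 1 then (if (j : ℕ) = n + 1 then 1 else 0)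
    else if hj : (j : ℕ) = n + 1 then 0
    else
      g ⟨if (i : ℕ) < n + 1 then (i : ℕ) else (i : ℕ) - 1, by have := i.isLt; split <;> omega⟩
        ⟨if (j : ℕ) < n + 1 then (j : ℕ) else (j : ℕ) - 1, by have := j.isLt; split <;> omega⟩

/-- The middle `2n+2` block of the embedding of `SO_{2n+1}` into `SO_{2l}`. -/
def embLowMid (n : ℕ) (g : Matrix (Fin (2*n+1)) (Fin (2*n+1)) F) :
    Matrix (Fin (2*n+2)) (Fin (2*n+2)) F :=
  (Mlow F n)⁻¹ * insLow F n g * Mlow F n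

/-- The embedding of `SO_{2n+1}` into `SO_{2l}` (for `n < l`) at the matrix level. -/
def embLow (l n : ℕ) (g : Matrix (Fin (2*n+1)) (Fin (2*n+1)) F) :
    Matrix (Fin (2*l)) (Fin (2*l)) F :=
  Matrix.of fun i j =>
    if h : l - n - 1 ≤ (i : ℕ) ∧ (i : ℕ) < l + n + 1 ∧ l - n - 1 ≤ (j : ℕ) ∧ (j : ℕ) < l + n + 1
    then embLowMid F n g ⟨(i : ℕ) - (l - n - 1), by omega⟩ ⟨(j : ℕ) - (l - n - 1), by omega⟩
    else if i = j then 1 else 0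
/-- The maximal torus `T` of `SO_{2l}`. -/
def TSet (l : ℕ) (ρ : F) : Set (SO2l F l ρ) :=
  {g | ∃ (tv : ℕ → Fˣ) (a b : F), a^2 - b^2 * ρ = 1 ∧ mat F g = torusMat F l ρ tv a b}

/-- The split subtorus `S` of `T`. -/
def SSet (l : ℕ) (ρ : F) : Set (SO2l F l ρ) :=
  {g | ∃ tv : ℕ → Fˣ, mat F g = torusMat F l ρ tv 1 0}

/-- The standard Borel subgroup `B = T·U` of `SO_{2l}` (as a set). -/
def BorelSet (l : ℕ) (ρ : F) : Set (SO2l F l ρ) :=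
  {b | ∃ t ∈ TSet F l ρ, ∃ u ∈ USet F l ρ, b = t * u}

/-- `w` normalizes the torus `T`. -/
def NormalizesT (l : ℕ) (ρ : F) (w : SO2l F l ρ) : Prop :=
  ∀ t ∈ TSet F l ρ, w * t * w⁻¹ ∈ TSet F l ρ ∧ w⁻¹ * t * w ∈ TSet F l ρ

/-- Standard basis weight `e_k` (as an integral character vector). -/
def eVec (k : ℕ) : ℕ → ℤ := fun i => if i = k then 1 else 0

/-- The simple (restricted) roots of `SO_{2l}`: `α_k = e_k - e_{k+1}` for `k < l-2`
(0-indexed) and `α_{l-2} = e_{l-2}`. -/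
def simpleRoot (l k : ℕ) : ℕ → ℤ :=
  fun i => (if i = k then 1 else 0) - (if i = k + 1 ∧ k + 3 ≤ l then 1 else 0)

/-- The positive (restricted) roots of `SO_{2l}` (type `B_{l-1}`). -/
def posRoot (l : ℕ) : Set (ℕ → ℤ) :=
  {α | (∃ i j, i < j ∧ j < l - 1 ∧ α = fun k => eVec i k - eVec j k) ∨
       (∃ i j, i < j ∧ j < l - 1 ∧ α = fun k => eVec i k + eVec j k) ∨
       (∃ i, i < l - 1 ∧ α = eVec i)}

/-- Negative roots. -/
def negRoot (l : ℕ) : Set (ℕ → ℤ) := {α | (fun k => -(α k)) ∈ posRoot l}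

/-- Simple roots (as a set). -/
def isSimpleRoot (l : ℕ) (α : ℕ → ℤ) : Prop := ∃ k, k < l - 1 ∧ α = simpleRoot l k

/-- Evaluation of an integral character vector on an element of the split torus. -/
def rootEval (l : ℕ) (ρ : F) (α : ℕ → ℤ) (g : SO2l F l ρ) : F :=
  ∏ i : Fin (2*l), (if (i : ℕ) < l - 1 then (mat F g i i) ^ (α (i : ℕ)) else 1)

/-- The Weyl representative `w` maps the character `α` of `S` to the character `β`. -/
def mapsRoot (l : ℕ) (ρ : F) (w : SO2l F l ρ) (α β : ℕ → ℤ) : Prop :=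
  ∀ s ∈ SSet F l ρ, w⁻¹ * s * w ∈ SSet F l ρ ∧
    rootEval F l ρ β s = rootEval F l ρ α (w⁻¹ * s * w)

/-- The Weyl representative `w` supports Bessel functions: every simple root is mapped
to a negative or simple root. -/
def SupportsBessel (l : ℕ) (ρ : F) (w : SO2l F l ρ) : Prop :=
  ∀ k, k < l - 1 → ∃ β : ℕ → ℤ, mapsRoot F l ρ w (simpleRoot l k) β ∧
    (β ∈ negRoot l ∨ isSimpleRoot l β)

/-- `θ_w = {k : wα_k is positive}`. -/
def besselTheta (l : ℕ) (ρ : F) (w : SO2l F l ρ) : Set ℕ :=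
  {k | k < l - 1 ∧ ∃ β : ℕ → ℤ, mapsRoot F l ρ w (simpleRoot l k) β ∧ β ∈ posRoot l}

/-- The cell `B_n(SO_{2l}) = {t_n(w')·w̃_n : w' ∈ W(GL_n)}`. -/
def BnSet (l : ℕ) (ρ : F) (n : ℕ) : Set (SO2l F l ρ) :=
  {g | ∃ σ : Equiv.Perm (Fin n), mat F g = tnMat F l n (permMat F n σ) * wTildeMat F l n}

/-- Block index for the Siegel parabolic of `SO_{2n+1}`. -/
def blkSiegel (n i : ℕ) : ℕ := if i < n then 0 else if i = n then 1 else 2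

/-- The unipotent radical `V_n` of the Siegel parabolic of `SO_{2n+1}` (matrix level). -/
def VnSet (n : ℕ) : Set (Matrix (Fin (2*n+1)) (Fin (2*n+1)) F) :=
  {m | m ∈ SOset F (2*n+1) (Jmat F (2*n+1)) ∧
    ∀ i j : Fin (2*n+1), blkSiegel n (j : ℕ) ≤ blkSiegel n (i : ℕ) →
      m i j = if i = j then 1 else 0}

/-- The group `R^{l,n}` (matrix level). -/
def RlnSet (l : ℕ) (ρ : F) (n : ℕ) : Set (Matrix (Fin (2*l)) (Fin (2*l)) F) :=
  {m | m ∈ SOset F (2*l) (Jrho F l ρ) ∧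
    ∀ i j : Fin (2*l),
      ¬((n ≤ (i : ℕ) ∧ (i : ℕ) < l - 1 ∧ (j : ℕ) < n) ∨
        (2*l - n ≤ (i : ℕ) ∧ l + 1 ≤ (j : ℕ) ∧ (j : ℕ) < 2*l - n)) →
      m i j = if i = j then 1 else 0}

/-- The subgroup `N^{l-n} = U_{GL_{l-n-1}}·N_{l-n-1}` of `SO_{2l}`. -/
def NlnSet (l : ℕ) (ρ : F) (n : ℕ) : Set (SO2l F l ρ) :=
  {g | upUnip F (mat F g) ∧
    ∀ i j : Fin (2*l), l - n - 1 ≤ (i : ℕ) → (i : ℕ) < l + n + 1 →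
      l - n - 1 ≤ (j : ℕ) → (j : ℕ) < l + n + 1 →
      mat F g i j = if i = j then 1 else 0}

/-- Block index for standard parabolic subgroups of `SO_{2m+1}`, given cuts `C`. -/
def blkB (m : ℕ) (C : Finset ℕ) (i : ℕ) : ℕ :=
  (C.filter (fun c => c ≤ i)).card + (C.filter (fun c => 2*m + 1 - c ≤ i)).card

/-- The standard parabolic subgroup of `SO_{2m+1}` given by cuts `C` (as a set). -/
def pbP (m : ℕ) (C : Finset ℕ) : Set (SOodd F m) :=
  {g | ∀ i j : Fin (2*m+1), blkB m C (j : ℕ) < blkB m C (i : ℕ) → mat F g i j = 0}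

/-- The unipotent radical of the standard parabolic subgroup of `SO_{2m+1}` given by cuts `C`. -/
def pbV (m : ℕ) (C : Finset ℕ) : Set (SOodd F m) :=
  {g | ∀ i j : Fin (2*m+1), blkB m C (j : ℕ) ≤ blkB m C (i : ℕ) →
    mat F g i j = if i = j then 1 else 0}
/-- Apply a representation of `GL_n(F)` at a plain matrix (zero if not invertible). -/
def tauApp (n : ℕ) {Wτ : Type*} [AddCommGroup Wτ] [Module ℂ Wτ]
    (τ : Representation ℂ (GL (Fin n) F) Wτ) (m : Matrix (Fin n) (Fin n) F) :
    Wτ →ₗ[ℂ] Wτ :=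
  matFun (fun g : GL (Fin n) F => (g : Matrix (Fin n) (Fin n) F)) (fun g => τ g) m

/-- `Λ` is a nonzero `ψ⁻¹`-Whittaker functional for the representation `τ` of `GL_n(F)`. -/
def IsGenericGLinv (n : ℕ) (ψ : AddChar F ℂ) {Wτ : Type*} [AddCommGroup Wτ] [Module ℂ Wτ]
    (τ : Representation ℂ (GL (Fin n) F) Wτ) (Λ : Wτ →ₗ[ℂ] ℂ) : Prop :=
  Λ ≠ 0 ∧ ∀ u : GL (Fin n) F, upUnip F ((u : Matrix (Fin n) (Fin n) F)) →
    ∀ x : Wτ, Λ (τ u x) = ψ (-(glUSum F n (u : Matrix (Fin n) (Fin n) F))) * Λ x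

/-- The induced space `I(τ) = Ind_{Q_n}^{SO_{2n+1}} τ` (matrix level). -/
def IndTau (n : ℕ) {Wτ : Type*} [AddCommGroup Wτ] [Module ℂ Wτ]
    (τ : Representation ℂ (GL (Fin n) F) Wτ) :
    Set (Matrix (Fin (2*n+1)) (Fin (2*n+1)) F → Wτ) :=
  {ξ | (∀ g, g ∉ SOset F (2*n+1) (Jmat F (2*n+1)) → ξ g = 0) ∧
    ∀ a : GL (Fin n) F, ∀ u ∈ VnSet F n, ∀ g,
      ξ (lnMat F n (a : Matrix (Fin n) (Fin n) F) * u * g) = τ a (ξ g)}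

/-- The space `I(τ, ψ⁻¹)` spanned by the functions `f_ξ(g,a) = Λ(τ(a)ξ(g))`. -/
def Imodel (n : ℕ) {Wτ : Type*} [AddCommGroup Wτ] [Module ℂ Wτ]
    (τ : Representation ℂ (GL (Fin n) F) Wτ) (Λ : Wτ →ₗ[ℂ] ℂ) :
    Set (Matrix (Fin (2*n+1)) (Fin (2*n+1)) F → Matrix (Fin n) (Fin n) F → ℂ) :=
  {f | ∃ ξ ∈ IndTau F n τ, f = fun g a => Λ (tauApp F n τ a (ξ g))}

open Classical in
/-- The section `ξ_v ∈ I(τ)` supported on the Siegel parabolic with `ξ_v(l_n(a)u) = τ(a)v`. -/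
def xiv (n : ℕ) {Wτ : Type*} [AddCommGroup Wτ] [Module ℂ Wτ]
    (τ : Representation ℂ (GL (Fin n) F) Wτ) (v : Wτ) :
    Matrix (Fin (2*n+1)) (Fin (2*n+1)) F → Wτ :=
  fun m =>
    if h : ∃ p : (GL (Fin n) F) × Matrix (Fin (2*n+1)) (Fin (2*n+1)) F,
        p.2 ∈ VnSet F n ∧ m = lnMat F n ((p.1 : Matrix (Fin n) (Fin n) F)) * p.2
    then τ h.choose.1 v else 0

/-- The function `f_v = f_{ξ_v} ∈ I(τ, ψ⁻¹)`. -/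
def fvFun (n : ℕ) {Wτ : Type*} [AddCommGroup Wτ] [Module ℂ Wτ]
    (τ : Representation ℂ (GL (Fin n) F) Wτ) (Λ : Wτ →ₗ[ℂ] ℂ) (v : Wτ) :
    Matrix (Fin (2*n+1)) (Fin (2*n+1)) F → Matrix (Fin n) (Fin n) F → ℂ :=
  fun g a => Λ (tauApp F n τ a (xiv F n τ v g))

/-- The intertwining operator `M(τ, ψ⁻¹)` at the level of functions. -/
def MOp (n : ℕ)
    (f : Matrix (Fin (2*n+1)) (Fin (2*n+1)) F → Matrix (Fin n) (Fin n) F → ℂ) :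
    Matrix (Fin (2*n+1)) (Fin (2*n+1)) F → Matrix (Fin n) (Fin n) F → ℂ :=
  fun h a => ∑ᶠ u ∈ VnSet F n, f (wnOddMat F n * u * h) (dnMat F n * aStar F n a)

/-- The zeta integral for `n < l`, via the embedding `SO_{2n+1} → SO_{2l}`
(the sum over coset representatives is realized as `|U|⁻¹` times the full sum). -/
def ZetaLow (l : ℕ) (ρ : F) (n : ℕ) (φ : SO2l F l ρ → ℂ)
    (f : Matrix (Fin (2*n+1)) (Fin (2*n+1)) F → Matrix (Fin n) (Fin n) F → ℂ) : ℂ :=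
  (Nat.card (UoddMatSet F n) : ℂ)⁻¹ *
    ∑ᶠ g ∈ SOset F (2*n+1) (Jmat F (2*n+1)),
      (∑ᶠ r ∈ RlnSet F l ρ n,
        matFun (fun x : SO2l F l ρ => mat F x) φ
          (r * wlnMat F l n * embLow F l n g * (wlnMat F l n)⁻¹)) * f g 1

/-- The zeta integral for `n = l`, via the embedding `SO_{2l} → SO_{2l+1}`. -/
def ZetaTop (l : ℕ) (ρ : F) (φ : SO2l F l ρ → ℂ)
    (f : Matrix (Fin (2*l+1)) (Fin (2*l+1)) F → Matrix (Fin l) (Fin l) F → ℂ) : ℂ :=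
  (Nat.card (USet F l ρ) : ℂ)⁻¹ *
    ∑ᶠ g : SO2l F l ρ, φ g * f (wllMat F l ρ * embTop F l ρ (mat F g)) 1

/-- The combined zeta integral `Ψ` for `1 ≤ n ≤ l`. -/
def Zeta (l : ℕ) (ρ : F) (n : ℕ) (φ : SO2l F l ρ → ℂ)
    (f : Matrix (Fin (2*n+1)) (Fin (2*n+1)) F → Matrix (Fin n) (Fin n) F → ℂ) : ℂ :=
  if n < l then ZetaLow F l ρ n φ f
  else if h : n = l then ZetaTop F l ρ φ (cast (by rw [h]) f)
  else 0

/-- `c` is the gamma factor `γ(π × τ, ψ)`: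
`c · Ψ(W_v, f) = Ψ(W_v, M(τ,ψ⁻¹) f)` for all Whittaker functions `W_v` of `π`
and all `f ∈ I(τ, ψ⁻¹)`. -/
def IsGamma (l : ℕ) (ρ : F) (n : ℕ) {V : Type*} [AddCommGroup V] [Module ℂ V]
    (π : Representation ℂ (SO2l F l ρ) V) (Γ : V →ₗ[ℂ] ℂ)
    {Wτ : Type*} [AddCommGroup Wτ] [Module ℂ Wτ]
    (τ : Representation ℂ (GL (Fin n) F) Wτ) (Λ : Wτ →ₗ[ℂ] ℂ) (c : ℂ) : Prop :=
  ∀ v : V, ∀ f ∈ Imodel F n τ Λ,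
    c * Zeta F l ρ n (fun g => Γ (π g v)) f =
      Zeta F l ρ n (fun g => Γ (π g v)) (MOp F n f)

/-- The Bessel function of the conjugate representation `π^c`:
`B_{π^c,ψ}(g) = B_{π,ψ}(c·t̃⁻¹·g·t̃·c)`. -/
def BesselConj (l : ℕ) (ρ : F) (B : SO2l F l ρ → ℂ) : SO2l F l ρ → ℂ :=
  fun g => matFun (fun x : SO2l F l ρ => mat F x) B
    (cMat F l * (tTildeMat F l)⁻¹ * mat F g * tTildeMat F l * cMat F l)

section

variable {K : Type} [Field K]

/-- The block index of a row or column: the two middle indices `l - 1` and `l` form one block,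
labelled `l - 1`. -/
def midBlk (l i : ℕ) : ℕ := if i = l then l - 1 else i

/-- The involution of the indices that fixes the two middle ones and reverses the others. -/
def starIdx (l : ℕ) (i : Fin (2*l)) : Fin (2*l) :=
  if midBlk l i = l - 1 then i else i.rev

/-- The nonzero entries of `J_{2l,ρ}`. -/
def jCoeff (l : ℕ) (ρ : K) (i : Fin (2*l)) : K := if (i : ℕ) = l then -ρ else 1

lemma val_starIdx (l : ℕ) (i : Fin (2*l)) :
    (starIdx l i : ℕ) = if midBlk l i = l - 1 then (i : ℕ) else 2*l - 1 - i := by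
  unfold starIdx
  split_ifs with h
  · rfl
  · rw [Fin.val_rev]; omega

lemma starIdx_starIdx (l : ℕ) (i : Fin (2*l)) : starIdx l (starIdx l i) = i := by
  have h := val_starIdx l (starIdx l i)
  have h' := val_starIdx l i
  ext
  unfold midBlk at *
  split_ifs at * <;> omega

lemma eq_starIdx_comm {l : ℕ} {i j : Fin (2*l)} : i = starIdx l j ↔ starIdx l i = j :=
  ⟨fun h => by rw [h, starIdx_starIdx], fun h => by rw [← h, starIdx_starIdx]⟩

lemma midBlk_starIdx (l : ℕ) (i : Fin (2*l)) :
    midBlk l (starIdx l i) = if midBlk l i = l - 1 then l - 1 else 2*l - 1 - midBlk l i := by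
  rw [val_starIdx]
  unfold midBlk
  split_ifs <;> omega

lemma midBlk_starIdx_ne {l : ℕ} {i : Fin (2*l)} (hi : midBlk l i ≠ l - 1) :
    midBlk l (starIdx l i) ≠ l - 1 := by
  rw [val_starIdx]
  unfold midBlk at *
  split_ifs at * <;> omega

lemma jCoeff_ne_zero {l : ℕ} {ρ : K} (hρ : ρ ≠ 0) (i : Fin (2*l)) : jCoeff l ρ i ≠ 0 := by
  unfold jCoeff
  split_ifs
  · exact neg_ne_zero.mpr hρ
  · exact one_ne_zero

lemma Jrho_apply {l : ℕ} (hl : 2 ≤ l) (ρ : K) (i j : Fin (2*l)) :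
    Jrho K l ρ i j = if j = starIdx l i then jCoeff l ρ i else 0 := by
  have hJ : Jrho K l ρ i j = Dmat K l ρ i j.rev := by
    rw [Jrho, Matrix.mul_apply, Finset.sum_eq_single j.rev]
    · simp only [Jmat, Matrix.of_apply, Fin.val_rev]
      rw [if_pos (by omega), mul_one]
    · intro a _ ha
      simp only [Jmat, Matrix.of_apply]
      rw [if_neg, mul_zero]
      intro h
      apply ha
      ext
      rw [Fin.val_rev]; omega
    · simp
  rw [hJ]
  have h1 := val_starIdx l i
  simp only [Dmat, Matrix.of_apply, jCoeff, Fin.ext_iff, h1, Fin.val_rev, midBlk]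
  have := i.isLt
  have := j.isLt
  split_ifs <;> first | rfl | (exfalso; omega)

lemma Jrho_mul_apply {l : ℕ} (hl : 2 ≤ l) (ρ : K) (M : Matrix (Fin (2*l)) (Fin (2*l)) K)
    (i j : Fin (2*l)) : (Jrho K l ρ * M) i j = jCoeff l ρ i * M (starIdx l i) j := by
  simp [Matrix.mul_apply, Jrho_apply hl]

lemma mul_Jrho_apply {l : ℕ} (hl : 2 ≤ l) (ρ : K) (M : Matrix (Fin (2*l)) (Fin (2*l)) K)
    (i j : Fin (2*l)) :
    (M * Jrho K l ρ) i j = M i (starIdx l j) * jCoeff l ρ (starIdx l j) := by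
  simp [Matrix.mul_apply, Jrho_apply hl, eq_comm (a := j), ← eq_starIdx_comm]

lemma mat_mul {m : ℕ} {Jm : Matrix (Fin m) (Fin m) K} (g h : SOgrp K m Jm) :
    mat K (g * h) = mat K g * mat K h := rfl

lemma mat_one {m : ℕ} {Jm : Matrix (Fin m) (Fin m) K} :
    mat K (1 : SOgrp K m Jm) = 1 := rfl

lemma mat_mul_mat_inv {m : ℕ} {Jm : Matrix (Fin m) (Fin m) K} (g : SOgrp K m Jm) :
    mat K g * mat K g⁻¹ = 1 := by rw [← mat_mul, mul_inv_cancel, mat_one]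

lemma mat_inv_mul_mat {m : ℕ} {Jm : Matrix (Fin m) (Fin m) K} (g : SOgrp K m Jm) :
    mat K g⁻¹ * mat K g = 1 := by rw [← mat_mul, inv_mul_cancel, mat_one]

lemma mat_isometry {m : ℕ} {Jm : Matrix (Fin m) (Fin m) K} (g : SOgrp K m Jm) :
    (mat K g)ᵀ * Jm * mat K g = Jm := g.2.2

/-- The entries of the inverse of an element of `SO_{2l}`, up to nonzero factors. -/
lemma mat_inv_apply {l : ℕ} (hl : 2 ≤ l) {ρ : K} (g : SO2l K l ρ) (i j : Fin (2*l)) :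
    jCoeff l ρ (starIdx l i) * mat K g⁻¹ i j =
      mat K g (starIdx l j) (starIdx l i) * jCoeff l ρ (starIdx l j) := by
  have h : Jrho K l ρ * mat K g⁻¹ = (mat K g)ᵀ * Jrho K l ρ := by
    have h' := congrArg (· * mat K g⁻¹) (mat_isometry g)
    simp only [Matrix.mul_assoc, mat_mul_mat_inv, Matrix.mul_one] at h'
    exact h'.symm
  have h' := congrFun (congrFun h (starIdx l i)) j
  rwa [Jrho_mul_apply hl, mul_Jrho_apply hl, starIdx_starIdx, Matrix.transpose_apply] at h'

lemma mat_inv_ne_zero_iff {l : ℕ} (hl : 2 ≤ l) {ρ : K} (hρ : ρ ≠ 0) (g : SO2l K l ρ)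
    (i j : Fin (2*l)) :
    mat K g⁻¹ i j ≠ 0 ↔ mat K g (starIdx l j) (starIdx l i) ≠ 0 := by
  have h := mat_inv_apply hl g i j
  have h1 := jCoeff_ne_zero hρ (starIdx l i)
  have h2 := jCoeff_ne_zero hρ (starIdx l j)
  constructor <;> intro h3 h4 <;> rw [h4] at h <;> simp_all

/-- Build an element of `SO_{2l}` from its matrix. -/
def mkSO {m : ℕ} {Jm : Matrix (Fin m) (Fin m) K} (M : Matrix (Fin m) (Fin m) K)
    (hdet : M.det = 1) (hJ : Mᵀ * Jm * M = Jm) : SOgrp K m Jm :=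
  ⟨Matrix.GeneralLinearGroup.mkOfDetNeZero M (by rw [hdet]; exact one_ne_zero), hdet, hJ⟩

lemma mat_mkSO {m : ℕ} {Jm : Matrix (Fin m) (Fin m) K} (M : Matrix (Fin m) (Fin m) K)
    (hdet : M.det = 1) (hJ : Mᵀ * Jm * M = Jm) : mat K (mkSO M hdet hJ) = M := rfl

/-- The diagonal entries of `torusMat` outside the middle block. -/
def torusDiag (l : ℕ) (tv : ℕ → Kˣ) (i : ℕ) : K :=
  if i < l - 1 then (tv i : K) else ((tv (2*l - 1 - i))⁻¹ : Kˣ)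

lemma torusMat_apply_of_ne {l : ℕ} (ρ : K) (tv : ℕ → Kˣ) (a b : K) {i j : Fin (2*l)}
    (h : midBlk l i ≠ l - 1 ∨ midBlk l j ≠ l - 1) :
    torusMat K l ρ tv a b i j = if i = j then torusDiag l tv i else 0 := by
  simp only [torusMat, Matrix.of_apply, torusDiag, Fin.ext_iff, midBlk] at *
  have := i.isLt
  have := j.isLt
  split_ifs at * <;> first | rfl | (exfalso; omega) | simp

lemma torusMat_ne_zero {l : ℕ} {ρ : K} {tv : ℕ → Kˣ} {a b : K} {i j : Fin (2*l)}
    (h : torusMat K l ρ tv a b i j ≠ 0) : midBlk l i = midBlk l j := by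
  by_cases h' : midBlk l i ≠ l - 1 ∨ midBlk l j ≠ l - 1
  · rw [torusMat_apply_of_ne ρ tv a b h'] at h
    split_ifs at h with h''
    · rw [h'']
    · exact absurd rfl h
  · push Not at h'
    rw [h'.1, h'.2]

lemma torusDiag_mul_starIdx {l : ℕ} (tv : ℕ → Kˣ) {i : Fin (2*l)}
    (h : midBlk l i ≠ l - 1) : torusDiag l tv i * torusDiag l tv (starIdx l i) = 1 := by
  have h1 := val_starIdx l i
  have := i.isLt
  rw [if_neg h] at h1
  unfold torusDiag midBlk at *
  by_cases h2 : (i : ℕ) < l - 1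
  · rw [if_pos h2, if_neg (by split_ifs at h <;> omega), h1,
      show 2*l - 1 - (2*l - 1 - (i : ℕ)) = i by omega]
    simp
  · rw [if_neg h2, if_pos (by split_ifs at h <;> omega), h1]
    simp

lemma sum_eq_add_mid {l : ℕ} (hl : 2 ≤ l) (f : Fin (2*l) → K)
    (hf : ∀ i : Fin (2*l), midBlk l i ≠ l - 1 → f i = 0) :
    ∑ i, f i = f ⟨l - 1, by omega⟩ + f ⟨l, by omega⟩ := by
  apply Fintype.sum_eq_add
  · simp only [ne_eq, Fin.mk.injEq]; omega
  · intro x hx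
    apply hf
    simp only [ne_eq, Fin.ext_iff] at hx
    unfold midBlk
    split_ifs <;> omega

lemma torusMat_isometry {l : ℕ} (hl : 2 ≤ l) {ρ : K} (tv : ℕ → Kˣ) {a b : K}
    (h : a^2 - b^2 * ρ = 1) :
    (torusMat K l ρ tv a b)ᵀ * Jrho K l ρ * torusMat K l ρ tv a b = Jrho K l ρ := by
  ext i j
  rw [Matrix.mul_assoc, Matrix.mul_apply]
  simp only [Jrho_mul_apply hl, Matrix.transpose_apply]
  by_cases hi : midBlk l i ≠ l - 1
  · rw [Finset.sum_eq_single i]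
    · rw [torusMat_apply_of_ne _ _ _ _ (Or.inl hi), if_pos rfl, torusMat_apply_of_ne, Jrho_apply hl]
      · simp only [eq_comm (a := j)]
        split_ifs
        · rw [mul_left_comm, torusDiag_mul_starIdx tv hi, mul_one]
        · simp
      · left
        exact midBlk_starIdx_ne hi
    · intro x _ hx
      rw [torusMat_apply_of_ne _ _ _ _ (Or.inr hi), if_neg hx, zero_mul]
    · simp
  · push Not at hi
    rw [sum_eq_add_mid hl]
    · have e1 : starIdx l ⟨l - 1, by omega⟩ = ⟨l - 1, by omega⟩ := by
        rw [starIdx, if_pos]; unfold midBlk; split_ifs <;> simp_all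
      have e2 : starIdx l ⟨l, by omega⟩ = ⟨l, by omega⟩ := by
        rw [starIdx, if_pos]; unfold midBlk; simp
      have hl0 : l - 1 ≠ l := by omega
      have e3 : starIdx l i = i := by rw [starIdx, if_pos hi]
      rw [e1, e2, Jrho_apply hl, e3]
      simp only [torusMat, Matrix.of_apply, jCoeff, Fin.ext_iff, midBlk] at *
      have hi' : (i : ℕ) = l - 1 ∨ (i : ℕ) = l := by split_ifs at hi <;> omega
      by_cases hj' : (j : ℕ) = l - 1 ∨ (j : ℕ) = l
      · rcases hi' with hi' | hi' <;> rcases hj' with hj' | hj' <;>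
          simp only [hi', hj', hl0, hl0.symm, if_true, if_false, lt_irrefl,
            show ¬ l < l - 1 by omega]
        all_goals first | ring1 | linear_combination h | linear_combination (-ρ) * h
      · push Not at hj'
        have h3 : ¬ (j : ℕ) = i := by omega
        simp [hl0.symm, hj'.1, hj'.2, h3, show ¬ l < l - 1 by omega]
    · intro x hx
      rw [torusMat_apply_of_ne _ _ _ _ (Or.inl hx), if_neg, zero_mul]
      rintro rfl
      exact hx hi

lemma torusMat_det {l : ℕ} (hl : 2 ≤ l) {ρ : K} (tv : ℕ → Kˣ) {a b : K}
    (h : a^2 - b^2 * ρ = 1) : (torusMat K l ρ tv a b).det = 1 := by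
  rw [Matrix.twoBlockTriangular_det _ (fun i : Fin (2*l) => midBlk l i = l - 1)]
  · have h1 : (toSquareBlockProp (torusMat K l ρ tv a b)
        (fun i : Fin (2*l) => midBlk l i = l - 1)).det = 1 := by
      have hl0 : l - 1 ≠ l := by omega
      let e : Fin 2 ≃ {i : Fin (2*l) // midBlk l i = l - 1} :=
        { toFun := fun k => if k = 0 then ⟨⟨l - 1, by omega⟩, by simp [midBlk]⟩
            else ⟨⟨l, by omega⟩, by simp [midBlk]⟩
          invFun := fun i => if (i.1 : ℕ) = l - 1 then 0 else 1
          left_inv := by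
            intro k
            fin_cases k <;> simp [hl0.symm]
          right_inv := by
            rintro ⟨i, hi⟩
            have hi' : (i : ℕ) = l - 1 ∨ (i : ℕ) = l := by
              unfold midBlk at hi; split_ifs at hi <;> omega
            apply Subtype.ext
            apply Fin.ext
            rcases hi' with hi' | hi' <;> simp [hi', hl0.symm] }
      rw [← Matrix.det_submatrix_equiv_self e, Matrix.det_fin_two]
      simp only [e, Matrix.submatrix_apply, toSquareBlockProp_def, torusMat, Matrix.of_apply]
      simp [hl0.symm, show ¬ l < l - 1 by omega]
      linear_combination h
    have h2 : toSquareBlockProp (torusMat K l ρ tv a b)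
        (fun i : Fin (2*l) => ¬ midBlk l i = l - 1) =
        Matrix.diagonal (fun i => torusDiag l tv (i.1 : ℕ)) := by
      ext i j
      rw [toSquareBlockProp_def, Matrix.of_apply, torusMat_apply_of_ne _ _ _ _ (Or.inl i.2),
        Matrix.diagonal_apply]
      simp only [Subtype.ext_iff]
    have hstar (i : Fin (2*l)) (hi : ¬ midBlk l i = l - 1) :
        ¬ midBlk l (starIdx l i) = l - 1 := midBlk_starIdx_ne hi
    rw [h1, h2, Matrix.det_diagonal, one_mul]
    apply Finset.prod_ninvolution (fun i => ⟨starIdx l i.1, hstar i.1 i.2⟩)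
    · intro i
      exact torusDiag_mul_starIdx tv i.2
    · intro i _ h'
      have h3 := val_starIdx l i.1
      have h4 := congrArg (fun x => (x.1 : ℕ)) h'
      have h5 := i.2
      simp only at h4
      rw [if_neg h5] at h3
      unfold midBlk at h5
      split_ifs at h5 <;> omega
    · simp
    · intro i
      exact Subtype.ext (starIdx_starIdx l i.1)
  · intro i hi j hj
    by_contra h'
    exact hi ((torusMat_ne_zero h').trans hj)

lemma exists_mat_eq_torusMat {l : ℕ} (hl : 2 ≤ l) {ρ : K} (tv : ℕ → Kˣ) {a b : K}
    (h : a^2 - b^2 * ρ = 1) : ∃ t ∈ TSet K l ρ, mat K t = torusMat K l ρ tv a b :=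
  ⟨mkSO _ (torusMat_det hl tv h) (torusMat_isometry hl tv h), ⟨tv, a, b, h, mat_mkSO _ _ _⟩,
    mat_mkSO _ _ _⟩

lemma torusMat_mul_apply {l : ℕ} {ρ : K} (tv : ℕ → Kˣ) (a b : K)
    (M : Matrix (Fin (2*l)) (Fin (2*l)) K) {i : Fin (2*l)} (hi : midBlk l i ≠ l - 1)
    (j : Fin (2*l)) : (torusMat K l ρ tv a b * M) i j = torusDiag l tv i * M i j := by
  simp [Matrix.mul_apply, torusMat_apply_of_ne _ _ _ _ (Or.inl hi)]

lemma mul_torusMat_apply {l : ℕ} {ρ : K} (tv : ℕ → Kˣ) (a b : K)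
    (M : Matrix (Fin (2*l)) (Fin (2*l)) K) (i : Fin (2*l)) {j : Fin (2*l)}
    (hj : midBlk l j ≠ l - 1) :
    (M * torusMat K l ρ tv a b) i j = M i j * torusDiag l tv j := by
  simp [Matrix.mul_apply, torusMat_apply_of_ne _ _ _ _ (Or.inr hj)]

lemma NormalizesT.inv {l : ℕ} {ρ : K} {w : SO2l K l ρ} (hw : NormalizesT K l ρ w) :
    NormalizesT K l ρ w⁻¹ := by
  intro t ht
  rw [inv_inv]
  exact (hw t ht).symm

lemma NormalizesT.exists_mat_mul_eq {l : ℕ} {ρ : K} {w : SO2l K l ρ}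
    (hw : NormalizesT K l ρ w) {t : SO2l K l ρ} (ht : t ∈ TSet K l ρ) :
    ∃ (tv : ℕ → Kˣ) (a b : K), mat K w * mat K t = torusMat K l ρ tv a b * mat K w := by
  obtain ⟨tv, a, b, -, h⟩ := (hw t ht).1
  refine ⟨tv, a, b, ?_⟩
  rw [← h, ← mat_mul, ← mat_mul, inv_mul_cancel_right]

lemma exists_torus_ne_zero {ρ : K} (h2 : (2 : K) ≠ 0) (hρ : ∀ x : K, x ^ 2 ≠ ρ) :
    ∃ a b : K, a ^ 2 - b ^ 2 * ρ = 1 ∧ b ≠ 0 := by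
  have h1 : 1 - ρ ≠ 0 := fun h => hρ 1 (by linear_combination h)
  refine ⟨(1 + ρ) / (1 - ρ), 2 / (1 - ρ), ?_, div_ne_zero h2 h1⟩
  field_simp
  ring

/-- An element normalizing the torus does not mix the middle coordinates into the others. -/
lemma NormalizesT.apply_eq_zero {l : ℕ} (hl : 2 ≤ l) {ρ : K} (h2 : (2 : K) ≠ 0)
    (hρ : ∀ x : K, x ^ 2 ≠ ρ) {w : SO2l K l ρ} (hw : NormalizesT K l ρ w) {i j : Fin (2*l)}
    (hi : midBlk l i ≠ l - 1) (hj : midBlk l j = l - 1) : mat K w i j = 0 := by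
  obtain ⟨a, b, hab, hb⟩ := exists_torus_ne_zero h2 hρ
  obtain ⟨t, ht, htm⟩ := exists_mat_eq_torusMat hl 1 hab
  obtain ⟨tv, a', b', h⟩ := hw.exists_mat_mul_eq ht
  rw [htm] at h
  have hl0 : l - 1 ≠ l := by omega
  have h' (k : Fin (2*l)) (hk : midBlk l k = l - 1) :
      mat K w i ⟨l - 1, by omega⟩ * torusMat K l ρ 1 a b ⟨l - 1, by omega⟩ k +
      mat K w i ⟨l, by omega⟩ * torusMat K l ρ 1 a b ⟨l, by omega⟩ k =
      torusDiag l tv i * mat K w i k := by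
    rw [← torusMat_mul_apply tv a' b' (mat K w) hi k, ← h, Matrix.mul_apply, sum_eq_add_mid hl]
    intro x hx
    rw [torusMat_apply_of_ne _ _ _ _ (Or.inl hx), if_neg, mul_zero]
    rintro rfl
    exact hx hk
  have h3 := h' ⟨l - 1, by omega⟩ (by simp [midBlk])
  have h4 := h' ⟨l, by omega⟩ (by simp [midBlk])
  simp only [torusMat, Matrix.of_apply, lt_irrefl, if_false, if_true, hl0.symm,
    show ¬ l < l - 1 by omega] at h3 h4
  set x := mat K w i ⟨l - 1, by omega⟩
  set y := mat K w i ⟨l, by omega⟩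
  set d := torusDiag l tv i
  have hx : x = 0 := by
    by_contra hx
    apply hρ ((a - d) / b)
    have h5 : x * ((a - d) ^ 2 - b ^ 2 * ρ) = 0 := by
      linear_combination (a - d) * h3 - b * h4
    have h6 := (mul_eq_zero.mp h5).resolve_left hx
    field_simp
    linear_combination h6
  have hy : y = 0 := by
    rw [hx] at h3
    have : y * b = 0 := by linear_combination h3
    exact (mul_eq_zero.mp this).resolve_right hb
  have hj' : (j : ℕ) = l - 1 ∨ (j : ℕ) = l := by
    unfold midBlk at hj; split_ifs at hj <;> omega
  rcases hj' with hj' | hj'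
  · rwa [show j = ⟨l - 1, by omega⟩ from Fin.ext hj']
  · rwa [show j = ⟨l, by omega⟩ from Fin.ext hj']

lemma NormalizesT.apply_eq_zero' {l : ℕ} (hl : 2 ≤ l) {ρ : K} (h2 : (2 : K) ≠ 0)
    (hρ : ∀ x : K, x ^ 2 ≠ ρ) {w : SO2l K l ρ} (hw : NormalizesT K l ρ w) {i j : Fin (2*l)}
    (hi : midBlk l i = l - 1) (hj : midBlk l j ≠ l - 1) : mat K w i j = 0 := by
  have hρ0 : ρ ≠ 0 := fun h => hρ 0 (by rw [h]; simp)
  by_contra h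
  rw [← starIdx_starIdx l i, ← starIdx_starIdx l j, ← ne_eq, ← mat_inv_ne_zero_iff hl hρ0] at h
  refine h (hw.inv.apply_eq_zero hl h2 hρ (midBlk_starIdx_ne hj) ?_)
  rw [midBlk_starIdx, if_pos hi]

/-- Outside the middle block, each row of an element normalizing the torus has a single nonzero
entry. -/
lemma NormalizesT.exists_row {l : ℕ} (hl : 2 ≤ l) {ρ : K} (h2 : (2 : K) ≠ 0)
    (hρ : ∀ x : K, x ^ 2 ≠ ρ) {w : SO2l K l ρ} (hw : NormalizesT K l ρ w) {i : Fin (2*l)}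
    (hi : midBlk l i ≠ l - 1) :
    ∃ k : Fin (2*l), midBlk l k ≠ l - 1 ∧ mat K w i k ≠ 0 ∧ ∀ j, mat K w i j ≠ 0 → j = k := by
  have hρ0 : ρ ≠ 0 := fun h => hρ 0 (by rw [h]; simp)
  obtain ⟨k, hk⟩ : ∃ k, mat K w i k ≠ 0 := by
    by_contra! h
    have h1 := congrFun (congrFun (mat_mul_mat_inv w) i) i
    rw [Matrix.mul_apply] at h1
    simp [h] at h1
  have hkm : midBlk l k ≠ l - 1 := fun hkm => hk (hw.apply_eq_zero hl h2 hρ hi hkm)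
  refine ⟨k, hkm, hk, ?_⟩
  -- The number `m` is the index of `k` or of its reverse lying in the first half
  let m : ℕ := if (k : ℕ) < l - 1 then k else 2*l - 1 - k
  let tv : ℕ → Kˣ := fun x => if x = m then -1 else 1
  obtain ⟨t, ht, htm⟩ := exists_mat_eq_torusMat (ρ := ρ) hl tv (a := 1) (b := 0) (by ring)
  obtain ⟨tv', a', b', h⟩ := hw.exists_mat_mul_eq ht
  rw [htm] at h
  have h3 (j : Fin (2*l)) (hj : midBlk l j ≠ l - 1) (hij : mat K w i j ≠ 0) :
      torusDiag l tv j = torusDiag l tv' i := by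
    have h4 := congrFun (congrFun h i) j
    rw [mul_torusMat_apply _ _ _ _ _ hj, torusMat_mul_apply _ _ _ _ hi, mul_comm] at h4
    exact mul_right_cancel₀ hij h4
  have hdiag (j : Fin (2*l)) (hj : midBlk l j ≠ l - 1) :
      torusDiag l tv j = if j = k ∨ j = starIdx l k then -1 else 1 := by
    have h5 := val_starIdx l k
    rw [if_neg hkm] at h5
    simp only [torusDiag, tv, m, Fin.ext_iff, h5]
    unfold midBlk at hj hkm
    split_ifs at * <;> first | (exfalso; omega) | simp
  have hsupp (j : Fin (2*l)) (hij : mat K w i j ≠ 0) : j = k ∨ j = starIdx l k := by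
    have hj : midBlk l j ≠ l - 1 := fun hj => hij (hw.apply_eq_zero hl h2 hρ hi hj)
    have h6 := (h3 j hj hij).trans (h3 k hkm hk).symm
    rw [hdiag j hj, hdiag k hkm, if_pos (Or.inl rfl)] at h6
    by_contra h7
    rw [if_neg h7] at h6
    exact h2 (by linear_combination h6)
  have hkne : k ≠ starIdx l k := by
    intro h5
    have h6 := val_starIdx l k
    rw [if_neg hkm, ← h5] at h6
    omega
  have hzero : mat K w i (starIdx l k) = 0 := by
    have h5 := congrFun (congrFun (mat_mul_mat_inv w) i) (starIdx l i)
    have hine : i ≠ starIdx l i := by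
      intro h5
      have h6 := val_starIdx l i
      rw [if_neg hi, ← h5] at h6
      omega
    have hj1 (x : Fin (2*l)) (hx : midBlk l x ≠ l - 1) : jCoeff l ρ x = 1 := by
      rw [jCoeff, if_neg]
      intro h6
      exact hx (by simp [midBlk, h6])
    have hinv (x : Fin (2*l)) (hx : midBlk l x ≠ l - 1) :
        mat K w⁻¹ x (starIdx l i) = mat K w i (starIdx l x) := by
      have h6 := mat_inv_apply hl w x (starIdx l i)
      rwa [starIdx_starIdx, hj1 _ hi, hj1 _ (midBlk_starIdx_ne hx), one_mul, mul_one] at h6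
    rw [Matrix.mul_apply, Matrix.one_apply_ne hine, Fintype.sum_eq_add k (starIdx l k) hkne,
      hinv _ hkm, hinv _ (midBlk_starIdx_ne hkm), starIdx_starIdx] at h5
    · have h6 : (2 * mat K w i k) * mat K w i (starIdx l k) = 0 := by linear_combination h5
      exact (mul_eq_zero.mp h6).resolve_left (mul_ne_zero h2 hk)
    · rintro x ⟨hx1, hx2⟩
      by_contra h6
      rcases hsupp x (left_ne_zero_of_mul h6) with h7 | h7
      · exact hx1 h7
      · exact hx2 h7
  intro j hij
  rcases hsupp j hij with h5 | h5
  · exact h5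
  · rw [h5] at hij
    exact absurd hzero hij

/-- `w` permutes the blocks of coordinates: up to torus factors it is the signed permutation `φ`
of the block indices. -/
structure PermutesBlocks (l : ℕ) (ρ : K) (w : SO2l K l ρ) (φ : ℕ → ℕ) : Prop where
  supp : ∀ a b : Fin (2*l), mat K w a b ≠ 0 → midBlk l a = φ (midBlk l b)
  supp_inv : ∀ a b : Fin (2*l), mat K w⁻¹ b a ≠ 0 → midBlk l a = φ (midBlk l b)

lemma PermutesBlocks.mul {l : ℕ} {ρ : K} {v w : SO2l K l ρ} {φ χ : ℕ → ℕ}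
    (hv : PermutesBlocks l ρ v φ) (hw : PermutesBlocks l ρ w χ) :
    PermutesBlocks l ρ (v * w) (φ ∘ χ) := by
  constructor
  · intro a b h
    rw [mat_mul, Matrix.mul_apply] at h
    obtain ⟨c, -, hc⟩ := Finset.exists_ne_zero_of_sum_ne_zero h
    rw [hv.supp a c (left_ne_zero_of_mul hc), hw.supp c b (right_ne_zero_of_mul hc),
      Function.comp_apply]
  · intro a b h
    rw [_root_.mul_inv_rev, mat_mul, Matrix.mul_apply] at h
    obtain ⟨c, -, hc⟩ := Finset.exists_ne_zero_of_sum_ne_zero h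
    rw [hv.supp_inv a c (right_ne_zero_of_mul hc), hw.supp_inv c b (left_ne_zero_of_mul hc),
      Function.comp_apply]

lemma permutesBlocks_of_mem_TSet {l : ℕ} (hl : 2 ≤ l) {ρ : K} (hρ : ρ ≠ 0) {t : SO2l K l ρ}
    (ht : t ∈ TSet K l ρ) : PermutesBlocks l ρ t id := by
  obtain ⟨tv, a, b, -, h⟩ := ht
  constructor
  · intro i j hij
    rw [h] at hij
    exact torusMat_ne_zero hij
  · intro i j hij
    rw [mat_inv_ne_zero_iff hl hρ, h] at hij
    have h1 := torusMat_ne_zero hij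
    rw [midBlk_starIdx, midBlk_starIdx] at h1
    have := i.isLt
    have := j.isLt
    simp only [id, midBlk] at *
    split_ifs at * <;> omega

lemma PermutesBlocks.conj_sub_one {l : ℕ} {ρ : K} {v : SO2l K l ρ} {φ : ℕ → ℕ}
    (hv : PermutesBlocks l ρ v φ) (u : SO2l K l ρ) (i j : Fin (2*l))
    (h : (mat K (v * u * v⁻¹) - 1) i j ≠ 0) :
    ∃ a b : Fin (2*l), (mat K u - 1) a b ≠ 0 ∧ midBlk l i = φ (midBlk l a) ∧
      midBlk l j = φ (midBlk l b) := by
  have h1 : mat K (v * u * v⁻¹) - 1 = mat K v * (mat K u - 1) * mat K v⁻¹ := by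
    rw [Matrix.mul_sub, Matrix.sub_mul, Matrix.mul_one, mat_mul_mat_inv, mat_mul, mat_mul]
  rw [h1, Matrix.mul_apply] at h
  obtain ⟨b, -, hb⟩ := Finset.exists_ne_zero_of_sum_ne_zero h
  have h2 := left_ne_zero_of_mul hb
  rw [Matrix.mul_apply] at h2
  obtain ⟨a, -, ha⟩ := Finset.exists_ne_zero_of_sum_ne_zero h2
  exact ⟨a, b, right_ne_zero_of_mul ha, hv.supp i a (left_ne_zero_of_mul ha),
    hv.supp_inv j b (right_ne_zero_of_mul hb)⟩

/-- The indices outside the middle block. -/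
def IsOuter (l x : ℕ) : Prop := x < 2*l ∧ x ≠ l - 1 ∧ x ≠ l

lemma isOuter_iff {l : ℕ} (i : Fin (2*l)) : IsOuter l i ↔ midBlk l i ≠ l - 1 := by
  have := i.isLt
  unfold IsOuter midBlk
  split_ifs <;> omega

lemma IsOuter.midBlk_eq {l x : ℕ} (h : IsOuter l x) : midBlk l x = x := if_neg h.2.2

lemma NormalizesT.exists_permutesBlocks {l : ℕ} (hl : 2 ≤ l) {ρ : K} (h2 : (2 : K) ≠ 0)
    (hρ : ∀ x : K, x ^ 2 ≠ ρ) {w : SO2l K l ρ} (hw : NormalizesT K l ρ w) :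
    ∃ φ : ℕ → ℕ, PermutesBlocks l ρ w φ ∧ φ (l - 1) = l - 1 ∧
      (∀ x, IsOuter l x → IsOuter l (φ x) ∧ φ (2*l - 1 - x) = 2*l - 1 - φ x) ∧
      ∀ x y, IsOuter l x → IsOuter l y → φ x = φ y → x = y := by
  have hρ0 : ρ ≠ 0 := fun h => hρ 0 (by rw [h]; simp)
  have hrow (k : Fin (2*l)) : ∃ m : Fin (2*l), IsOuter l k →
      IsOuter l m ∧ mat K w⁻¹ k m ≠ 0 ∧ ∀ j, mat K w⁻¹ k j ≠ 0 → j = m := by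
    by_cases hk : IsOuter l k
    · obtain ⟨m, hm, h⟩ := hw.inv.exists_row hl h2 hρ ((isOuter_iff k).mp hk)
      exact ⟨m, fun _ => ⟨(isOuter_iff m).mpr hm, h⟩⟩
    · exact ⟨k, fun h => absurd h hk⟩
  choose σ hσ using hrow
  have hstar {k : Fin (2*l)} (hk : IsOuter l k) : IsOuter l (starIdx l k) := by
    rw [isOuter_iff] at *
    exact midBlk_starIdx_ne hk
  have hdiag (k : Fin (2*l)) (hk : IsOuter l k) : mat K w (σ k) k ≠ 0 := by
    have h1 := congrFun (congrFun (mat_inv_mul_mat w) k) k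
    rw [Matrix.mul_apply, Finset.sum_eq_single (σ k), Matrix.one_apply_eq] at h1
    · intro h
      rw [h, mul_zero] at h1
      exact zero_ne_one h1
    · intro x _ hx
      by_contra h
      exact hx ((hσ k hk).2.2 x (left_ne_zero_of_mul h))
    · simp
  have hcol (a k : Fin (2*l)) (hk : IsOuter l k) (h : mat K w a k ≠ 0) :
      starIdx l a = σ (starIdx l k) := by
    refine (hσ _ (hstar hk)).2.2 _ ?_
    rwa [mat_inv_ne_zero_iff hl hρ0, starIdx_starIdx, starIdx_starIdx]
  have hσstar (k : Fin (2*l)) (hk : IsOuter l k) : σ (starIdx l k) = starIdx l (σ k) :=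
    (hcol _ k hk (hdiag k hk)).symm
  have hval {k : Fin (2*l)} (hk : IsOuter l k) : (starIdx l k : ℕ) = 2*l - 1 - k := by
    rw [val_starIdx, if_neg ((isOuter_iff k).mp hk)]
  let φ : ℕ → ℕ := fun x => if h : x < 2*l ∧ x ≠ l - 1 then σ ⟨x, h.1⟩ else l - 1
  have hφ (k : Fin (2*l)) (hk : IsOuter l k) : φ k = σ k := by
    simp only [φ]
    rw [dif_pos ⟨hk.1, hk.2.1⟩]
  have hφmid : φ (l - 1) = l - 1 := by simp [φ]
  have hmid {k : Fin (2*l)} (hk : ¬ IsOuter l k) : midBlk l k = l - 1 := by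
    rw [isOuter_iff] at hk
    exact not_not.mp hk
  refine ⟨φ, ⟨?_, ?_⟩, hφmid, ?_, ?_⟩
  · intro a b hab
    by_cases hb : IsOuter l b
    · have h1 := hcol a b hb hab
      rw [hσstar b hb] at h1
      have h3 : a = σ b := by rw [← starIdx_starIdx l a, h1, starIdx_starIdx]
      rw [hb.midBlk_eq, hφ b hb, h3, (hσ b hb).1.midBlk_eq]
    · rw [hmid hb, hφmid]
      by_contra h
      exact hab (hw.apply_eq_zero hl h2 hρ h (hmid hb))
  · intro a b hab
    by_cases hb : IsOuter l b
    · rw [hb.midBlk_eq, hφ b hb, (hσ b hb).2.2 a hab, (hσ b hb).1.midBlk_eq]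
    · rw [hmid hb, hφmid]
      by_contra h
      exact hab (hw.inv.apply_eq_zero' hl h2 hρ (hmid hb) h)
  · intro x hx
    have h1 := hφ ⟨x, hx.1⟩ hx
    have h3 := hφ _ (hstar (k := ⟨x, hx.1⟩) hx)
    rw [hval (k := ⟨x, hx.1⟩) hx, hσstar _ hx, hval (hσ ⟨x, hx.1⟩ hx).1] at h3
    simp only at h1 h3
    rw [h3, h1]
    exact ⟨(hσ _ hx).1, rfl⟩
  · intro x y hx hy hxy
    have h1 := hφ ⟨x, hx.1⟩ hx
    have h3 := hφ ⟨y, hy.1⟩ hy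
    simp only at h1 h3
    rw [h1, h3] at hxy
    have h4 : σ ⟨x, hx.1⟩ = σ ⟨y, hy.1⟩ := Fin.ext hxy
    obtain ⟨k, -, -, hk⟩ := hw.exists_row hl h2 hρ ((isOuter_iff _).mp (hσ ⟨x, hx.1⟩ hx).1)
    have h5 := hk _ (hdiag ⟨x, hx.1⟩ hx)
    rw [h4] at hk
    have h6 := hk _ (hdiag ⟨y, hy.1⟩ hy)
    have h7 := h5.trans h6.symm
    exact congrArg Fin.val h7

lemma mem_USet_iff {l : ℕ} (hl : 2 ≤ l) {ρ : K} (u : SO2l K l ρ) :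
    u ∈ USet K l ρ ↔ ∀ i j, (mat K u - 1) i j ≠ 0 → midBlk l i < midBlk l j := by
  have hl0 : l - 1 ≠ l := by omega
  constructor
  · intro hu i j hij
    have hu' : upUnip K (mat K u) := hu
    have h1 : i < j := by
      by_contra h
      rw [Matrix.sub_apply, hu' i j (by omega), Matrix.one_apply, sub_self] at hij
      exact hij rfl
    by_contra h
    have h1' : (i : ℕ) < j := h1
    have hi : (i : ℕ) = l - 1 := by unfold midBlk at h; split_ifs at h <;> omega
    have hj : (j : ℕ) = l := by unfold midBlk at h; split_ifs at h <;> omega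
    rw [Matrix.sub_apply, Matrix.one_apply_ne h1.ne, sub_zero] at hij
    apply hij
    have h3 := congrFun (congrFun (mat_isometry u) i) j
    have hsi : starIdx l i = i := by rw [starIdx, if_pos]; simp [midBlk, hi]
    rw [Matrix.mul_assoc, Matrix.mul_apply, Finset.sum_eq_single i, Jrho_mul_apply hl,
      Jrho_apply hl, hsi, if_neg h1.ne', Matrix.transpose_apply, hu' i i le_rfl, if_pos rfl,
      jCoeff, if_neg (by omega), one_mul, one_mul] at h3
    · exact h3
    · intro x _ hx
      rw [Jrho_mul_apply hl, Matrix.transpose_apply]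
      have hx' : (x : ℕ) ≠ i := fun h => hx (Fin.ext h)
      by_cases hxi : (i : ℕ) < x
      · rw [hu' x i hxi.le, if_neg hx, zero_mul]
      · have h4 := val_starIdx l x
        rw [if_neg (by unfold midBlk; split_ifs <;> omega)] at h4
        rw [hu' (starIdx l x) j (by omega), if_neg, mul_zero, mul_zero]
        rw [Fin.ext_iff]
        omega
    · simp
  · intro h i j hij
    have h1 : (mat K u - 1) i j = 0 := by
      by_contra h3
      have := h i j h3
      unfold midBlk at this
      split_ifs at this <;> omega
    rw [Matrix.sub_apply, sub_eq_zero] at h1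
    rw [h1, Matrix.one_apply]

lemma conj_mem_USet {l : ℕ} (hl : 2 ≤ l) {ρ : K} (hρ : ρ ≠ 0) {t u : SO2l K l ρ}
    (ht : t ∈ TSet K l ρ) (hu : u ∈ USet K l ρ) : t * u * t⁻¹ ∈ USet K l ρ := by
  rw [mem_USet_iff hl] at *
  intro i j hij
  obtain ⟨a, b, hab, hi, hj⟩ :=
    (permutesBlocks_of_mem_TSet hl hρ ht).conj_sub_one u i j hij
  rw [hi, hj]
  exact hu a b hab

lemma psiU_eq_one {l : ℕ} (ψ : AddChar K ℂ) (M : Matrix (Fin (2*l)) (Fin (2*l)) K)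
    (h : ∀ i j, (M - 1) i j ≠ 0 → ¬ (midBlk l j = midBlk l i + 1 ∧ midBlk l i + 2 ≤ l)) :
    psiU K l ψ M = 1 := by
  have h0 (i j : Fin (2*l)) (hij : i ≠ j) (h1 : midBlk l j = midBlk l i + 1)
      (h2 : midBlk l i + 2 ≤ l) : M i j = 0 := by
    by_contra h3
    refine h i j ?_ ⟨h1, h2⟩
    rwa [Matrix.sub_apply, Matrix.one_apply_ne hij, sub_zero]
  rw [psiU, Finset.sum_eq_zero, AddChar.map_zero_eq_one]
  intro i _
  apply Finset.sum_eq_zero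
  intro j _
  split_ifs with h1 h2
  · apply h0
    · rw [ne_eq, Fin.ext_iff]; omega
    · unfold midBlk; split_ifs <;> omega
    · unfold midBlk; split_ifs <;> omega
  · rw [h0, mul_zero]
    · rw [ne_eq, Fin.ext_iff]; omega
    · unfold midBlk; split_ifs <;> omega
    · unfold midBlk; split_ifs <;> omega
  · rfl

lemma exists_mat_eq_one_add {l : ℕ} {ρ : K} (N : Matrix (Fin (2*l)) (Fin (2*l)) K)
    (hN : ∀ i j, j ≤ i → N i j = 0)
    (hJ : Nᵀ * Jrho K l ρ + Jrho K l ρ * N + Nᵀ * Jrho K l ρ * N = 0) :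
    ∃ u : SO2l K l ρ, mat K u = 1 + N := by
  refine ⟨mkSO (1 + N) ?_ ?_, mat_mkSO _ _ _⟩
  · rw [Matrix.det_of_isUpperTriangular]
    · simp [hN]
    · intro i j hij
      have hij' : j < i := hij
      rw [Matrix.add_apply, Matrix.one_apply_ne hij'.ne', hN i j hij'.le, add_zero]
  · rw [Matrix.transpose_add, Matrix.transpose_one]
    calc (1 + Nᵀ) * Jrho K l ρ * (1 + N)
        = Jrho K l ρ + (Nᵀ * Jrho K l ρ + Jrho K l ρ * N + Nᵀ * Jrho K l ρ * N) := by
          noncomm_ring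
      _ = Jrho K l ρ := by rw [hJ, add_zero]

lemma Jrho_mul_single {l : ℕ} (hl : 2 ≤ l) (ρ : K) (i j : Fin (2*l)) (c : K) :
    Jrho K l ρ * Matrix.single i j c =
      Matrix.single (starIdx l i) j (jCoeff l ρ (starIdx l i) * c) := by
  ext a b
  rw [Jrho_mul_apply hl, Matrix.single_apply, Matrix.single_apply]
  simp only [eq_starIdx_comm]
  by_cases h : starIdx l i = a
  · simp [h]
  · simp [h]

lemma single_mul_Jrho {l : ℕ} (hl : 2 ≤ l) (ρ : K) (i j : Fin (2*l)) (c : K) :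
    Matrix.single i j c * Jrho K l ρ =
      Matrix.single i (starIdx l j) (c * jCoeff l ρ j) := by
  ext a b
  rw [mul_Jrho_apply hl, Matrix.single_apply, Matrix.single_apply]
  simp only [eq_starIdx_comm]
  by_cases h : starIdx l j = b
  · subst h
    simp [starIdx_starIdx]
  · simp [h]

/-- A unipotent element in the root subgroup of `e_k - e_{k+1}`. -/
lemma exists_unip_long {l k : ℕ} (hk : k + 3 ≤ l) (ρ : K) (ψ : AddChar K ℂ) (x : K) :
    ∃ u ∈ USet K l ρ, psiU K l ψ (mat K u) = ψ x ∧
      ∀ a b, (mat K u - 1) a b ≠ 0 → (midBlk l a = k ∧ midBlk l b = k + 1) ∨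
        (midBlk l a = 2*l - 2 - k ∧ midBlk l b = 2*l - 1 - k) := by
  have hl : 2 ≤ l := by omega
  let p : Fin (2*l) := ⟨k, by omega⟩
  let q : Fin (2*l) := ⟨k + 1, by omega⟩
  have hp : midBlk l p = k := by simp only [midBlk, p]; rw [if_neg]; omega
  have hq : midBlk l q = k + 1 := by simp only [midBlk, q]; rw [if_neg]; omega
  have hp' : (starIdx l p : ℕ) = 2*l - 1 - k := by rw [val_starIdx, if_neg (by omega)]
  have hq' : (starIdx l q : ℕ) = 2*l - 2 - k := by
    rw [val_starIdx, if_neg (by omega)]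
    simp only [q]
    omega
  have hp'' : midBlk l (starIdx l p) = 2*l - 1 - k := by rw [hp', midBlk, if_neg (by omega)]
  have hq'' : midBlk l (starIdx l q) = 2*l - 2 - k := by rw [hq', midBlk, if_neg (by omega)]
  have hj (i : Fin (2*l)) (hi : (i : ℕ) ≠ l) : jCoeff l ρ i = 1 := if_neg hi
  have hpj := hj p (by simp only [p]; omega)
  have hqj := hj q (by simp only [q]; omega)
  have hpj' := hj (starIdx l p) (by omega)
  have hqj' := hj (starIdx l q) (by omega)
  obtain ⟨u, hu⟩ := exists_mat_eq_one_add (ρ := ρ)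
    (Matrix.single p q x - Matrix.single (starIdx l q) (starIdx l p) x) (by
      intro i j hij
      rw [Matrix.sub_apply, Matrix.single_apply_of_ne, Matrix.single_apply_of_ne, sub_zero]
      · rintro ⟨rfl, rfl⟩
        rw [Fin.le_def] at hij
        omega
      · rintro ⟨rfl, rfl⟩
        rw [Fin.le_def] at hij
        simp only [p, q] at hij
        omega) (by
      simp only [Matrix.transpose_sub, Matrix.transpose_single, Matrix.sub_mul, Matrix.mul_sub,
        Jrho_mul_single hl, single_mul_Jrho hl, starIdx_starIdx, hpj, hqj, hpj', hqj', one_mul,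
        mul_one]
      rw [Matrix.single_mul_single_of_ne, Matrix.single_mul_single_of_ne,
        Matrix.single_mul_single_of_ne, Matrix.single_mul_single_of_ne]
      · abel
      all_goals
        simp only [ne_eq, Fin.ext_iff, hp', hq']
        try simp only [p, q]
        omega)
  have hN : mat K u - 1 = Matrix.single p q x - Matrix.single (starIdx l q) (starIdx l p) x := by
    rw [hu, add_sub_cancel_left]
  have hsupp : ∀ a b, (mat K u - 1) a b ≠ 0 → (midBlk l a = k ∧ midBlk l b = k + 1) ∨
        (midBlk l a = 2*l - 2 - k ∧ midBlk l b = 2*l - 1 - k) := by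
    intro a b hab
    rw [hN, Matrix.sub_apply, Matrix.single_apply, Matrix.single_apply] at hab
    by_cases h1 : p = a ∧ q = b
    · obtain ⟨rfl, rfl⟩ := h1
      exact Or.inl ⟨hp, hq⟩
    · by_cases h2 : starIdx l q = a ∧ starIdx l p = b
      · obtain ⟨rfl, rfl⟩ := h2
        exact Or.inr ⟨hq'', hp''⟩
      · rw [if_neg h1, if_neg h2, sub_zero] at hab
        exact absurd rfl hab
  refine ⟨u, ?_, ?_, hsupp⟩
  · rw [mem_USet_iff hl]
    intro a b hab
    have := hsupp a b hab
    omega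
  · have hzero (i j : Fin (2*l)) (hij : i ≠ j) (hi : (i : ℕ) + 2 ≤ l) (h : ¬ (p = i ∧ q = j)) :
        mat K u i j = 0 := by
      rw [hu, Matrix.add_apply, Matrix.sub_apply, Matrix.one_apply_ne hij,
        Matrix.single_apply_of_ne _ _ _ _ _ h, Matrix.single_apply_of_ne]
      · simp
      · rintro ⟨rfl, -⟩
        rw [hq'] at hi
        omega
    have hpq : (q : ℕ) = (p : ℕ) + 1 ∧ (p : ℕ) + 3 ≤ l := ⟨rfl, hk⟩
    rw [psiU, Finset.sum_eq_single p, Finset.sum_eq_single q, if_pos hpq,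
      hu, Matrix.add_apply, Matrix.sub_apply, Matrix.single_apply_same, Matrix.one_apply_ne,
      Matrix.single_apply_of_ne, sub_zero, zero_add]
    · rintro ⟨h1, -⟩
      rw [Fin.ext_iff, hq'] at h1
      simp only [p] at h1
      omega
    · simp [p, q]
    · intro j _ hj'
      have h3 : ¬ (p = p ∧ q = j) := fun h => hj' h.2.symm
      split_ifs with h1 h2
      · exact hzero p j (by rw [ne_eq, Fin.ext_iff]; omega) (by omega) h3
      · rw [hzero p j (by rw [ne_eq, Fin.ext_iff]; omega) (by omega) h3, mul_zero]
      · rfl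
    · simp
    · intro i _ hi
      apply Finset.sum_eq_zero
      intro j _
      have h3 : ¬ (p = i ∧ q = j) := fun h => hi h.1.symm
      split_ifs with h1 h2
      · exact hzero i j (by rw [ne_eq, Fin.ext_iff]; omega) (by omega) h3
      · rw [hzero i j (by rw [ne_eq, Fin.ext_iff]; omega) (by omega) h3, mul_zero]
      · rfl
    · simp

/-- A unipotent element in the root subgroup of `e_{l-1}`. -/
lemma exists_unip_short {l : ℕ} (hl : 2 ≤ l) {ρ : K} (h2 : (2 : K) ≠ 0) (hρ : ρ ≠ 0)
    (ψ : AddChar K ℂ) (x : K) :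
    ∃ u ∈ USet K l ρ, psiU K l ψ (mat K u) = ψ x ∧
      ∀ a b, (mat K u - 1) a b ≠ 0 → (midBlk l a = l - 2 ∧ midBlk l b = l - 1) ∨
        (midBlk l a = l - 1 ∧ midBlk l b = l + 1) ∨
        (midBlk l a = l - 2 ∧ midBlk l b = l + 1) := by
  let p : Fin (2*l) := ⟨l - 2, by omega⟩
  let m : Fin (2*l) := ⟨l, by omega⟩
  have hp : midBlk l p = l - 2 := by simp only [midBlk, p]; rw [if_neg]; omega
  have hm : midBlk l m = l - 1 := by simp [midBlk, m]
  have hp' : (starIdx l p : ℕ) = l + 1 := by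
    rw [val_starIdx, if_neg (by omega)]
    simp only [p]
    omega
  have hm' : starIdx l m = m := by rw [starIdx, if_pos hm]
  have hp'' : midBlk l (starIdx l p) = l + 1 := by rw [hp', midBlk, if_neg (by omega)]
  have hpj : jCoeff l ρ p = 1 := if_neg (by simp only [p]; omega)
  have hpj' : jCoeff l ρ (starIdx l p) = 1 := if_neg (by omega)
  have hmj : jCoeff l ρ m = -ρ := if_pos rfl
  let c : K := 2 * x / ρ
  obtain ⟨u, hu⟩ := exists_mat_eq_one_add (ρ := ρ)
    (Matrix.single p m (2 * x) + Matrix.single m (starIdx l p) c +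
      Matrix.single p (starIdx l p) (2 * x ^ 2 / ρ)) (by
      intro i j hij
      rw [Matrix.add_apply, Matrix.add_apply, Matrix.single_apply_of_ne,
        Matrix.single_apply_of_ne, Matrix.single_apply_of_ne, add_zero, add_zero]
      all_goals
        rintro ⟨rfl, rfl⟩
        rw [Fin.le_def] at hij
        try simp only [hp'] at hij
        simp only [p, m] at hij
        omega) (by
      simp only [Matrix.transpose_add, Matrix.transpose_single, Matrix.add_mul, Matrix.mul_add,
        Jrho_mul_single hl, single_mul_Jrho hl, hpj, hpj', hmj, hm', one_mul,
        mul_one]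
      have hmp : m ≠ p := by simp only [ne_eq, Fin.ext_iff, m, p]; omega
      have hsp : starIdx l p ≠ p := by
        simp only [ne_eq, Fin.ext_iff, hp']
        simp only [p]
        omega
      have hsm : starIdx l p ≠ m := by
        simp only [ne_eq, Fin.ext_iff, hp', m]
        omega
      simp only [Matrix.single_mul_single_same, Matrix.single_mul_single_of_ne _ _ _ _ hmp,
        Matrix.single_mul_single_of_ne _ _ _ _ hsp, Matrix.single_mul_single_of_ne _ _ _ _ hsm]
      ext a b
      simp only [Matrix.add_apply, Matrix.zero_apply, Matrix.single_apply, c]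
      split_ifs <;> first | (exfalso; simp_all; done) | (field_simp; ring1))
  have hN : mat K u - 1 = Matrix.single p m (2 * x) + Matrix.single m (starIdx l p) c +
      Matrix.single p (starIdx l p) (2 * x ^ 2 / ρ) := by
    rw [hu, add_sub_cancel_left]
  have hsupp : ∀ a b, (mat K u - 1) a b ≠ 0 → (midBlk l a = l - 2 ∧ midBlk l b = l - 1) ∨
        (midBlk l a = l - 1 ∧ midBlk l b = l + 1) ∨
        (midBlk l a = l - 2 ∧ midBlk l b = l + 1) := by
    intro a b hab
    rw [hN] at hab
    simp only [Matrix.add_apply, Matrix.single_apply] at hab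
    by_cases h1 : p = a ∧ m = b
    · obtain ⟨rfl, rfl⟩ := h1
      exact Or.inl ⟨hp, hm⟩
    · by_cases h3 : m = a ∧ starIdx l p = b
      · obtain ⟨rfl, rfl⟩ := h3
        exact Or.inr (Or.inl ⟨hm, hp''⟩)
      · by_cases h4 : p = a ∧ starIdx l p = b
        · obtain ⟨rfl, rfl⟩ := h4
          exact Or.inr (Or.inr ⟨hp, hp''⟩)
        · rw [if_neg h1, if_neg h3, if_neg h4, add_zero, add_zero] at hab
          exact absurd rfl hab
  refine ⟨u, ?_, ?_, hsupp⟩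
  · rw [mem_USet_iff hl]
    intro a b hab
    have := hsupp a b hab
    omega
  · have hzero (i j : Fin (2*l)) (hij : i ≠ j) (hi : (i : ℕ) + 2 ≤ l) (hj : (j : ℕ) ≤ l)
        (h : ¬ (p = i ∧ m = j)) : mat K u i j = 0 := by
      rw [hu]
      simp only [Matrix.add_apply]
      rw [Matrix.one_apply_ne hij, Matrix.single_apply_of_ne _ _ _ _ _ h,
        Matrix.single_apply_of_ne, Matrix.single_apply_of_ne]
      · simp
      · rintro ⟨-, rfl⟩
        rw [hp'] at hj
        omega
      · rintro ⟨-, rfl⟩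
        rw [hp'] at hj
        omega
    have hpm1 : ¬ ((m : ℕ) = (p : ℕ) + 1 ∧ (p : ℕ) + 3 ≤ l) := by simp only [p, m]; omega
    have hpm2 : (p : ℕ) + 2 = l ∧ (m : ℕ) = l := ⟨Nat.sub_add_cancel hl, rfl⟩
    rw [psiU, Finset.sum_eq_single p, Finset.sum_eq_single m, if_neg hpm1, if_pos hpm2, hu]
    · simp only [Matrix.add_apply]
      rw [Matrix.single_apply_same, Matrix.one_apply_ne,
        Matrix.single_apply_of_ne, Matrix.single_apply_of_ne]
      · congr 1
        field_simp
        ring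
      · rintro ⟨-, h1⟩
        rw [Fin.ext_iff, hp'] at h1
        simp only [m] at h1
        omega
      · rintro ⟨-, h1⟩
        rw [Fin.ext_iff, hp'] at h1
        simp only [m] at h1
        omega
      · simp only [ne_eq, Fin.ext_iff, m, p]; omega
    · intro j _ hj'
      have h3 : ¬ (p = p ∧ m = j) := fun h => hj' h.2.symm
      split_ifs with h1 h4
      · exact hzero p j (by rw [ne_eq, Fin.ext_iff]; omega) (by omega) (by omega) h3
      · rw [hzero p j (by rw [ne_eq, Fin.ext_iff]; omega) (by omega) (by omega) h3, mul_zero]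
      · rfl
    · simp
    · intro i _ hi
      apply Finset.sum_eq_zero
      intro j _
      have h3 : ¬ (p = i ∧ m = j) := fun h => hi h.1.symm
      split_ifs with h1 h4
      · exact hzero i j (by rw [ne_eq, Fin.ext_iff]; omega) (by omega) (by omega) h3
      · rw [hzero i j (by rw [ne_eq, Fin.ext_iff]; omega) (by omega) (by omega) h3, mul_zero]
      · rfl
    · simp

/-- If conjugation by `v` carries an element `u` of `U` with `ψ(u) ≠ 1` into the kernel of the
generic character, then Whittaker functions vanish at `v`. -/
lemma whittaker_apply_eq_zero {F : Type} [Field F] [Fintype F] {l : ℕ} (hl : 2 ≤ l) {ρ : F}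
    {ψ : AddChar F ℂ} {V : Type} [AddCommGroup V] [Module ℂ V]
    {π : Representation ℂ (SO2l F l ρ) V} {Γ : V →ₗ[ℂ] ℂ} (hΓ : IsWhittaker F l ρ ψ π Γ)
    {v₀ : V} (hv₀ : IsWhitVec F l ρ ψ π Γ v₀) {v u : SO2l F l ρ} {φ : ℕ → ℕ}
    (hv : PermutesBlocks l ρ v φ) (hu : u ∈ USet F l ρ) (hψ : psiU F l ψ (mat F u) ≠ 1)
    (h : ∀ a b, (mat F u - 1) a b ≠ 0 → φ (midBlk l a) < φ (midBlk l b) ∧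
      ¬ (φ (midBlk l b) = φ (midBlk l a) + 1 ∧ φ (midBlk l a) + 2 ≤ l)) :
    Γ (π v v₀) = 0 := by
  have hU : v * u * v⁻¹ ∈ USet F l ρ := by
    rw [mem_USet_iff hl]
    intro i j hij
    obtain ⟨a, b, hab, hi, hj⟩ := hv.conj_sub_one u i j hij
    rw [hi, hj]
    exact (h a b hab).1
  have hone : psiU F l ψ (mat F (v * u * v⁻¹)) = 1 := by
    apply psiU_eq_one
    intro i j hij
    obtain ⟨a, b, hab, hi, hj⟩ := hv.conj_sub_one u i j hij
    rw [hi, hj]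
    exact (h a b hab).2
  have h1 : Γ (π (v * u) v₀) = psiU F l ψ (mat F u) * Γ (π v v₀) := by
    rw [map_mul, Module.End.mul_apply, hv₀.2 u hu, map_smul, map_smul, smul_eq_mul]
  have h2 : Γ (π (v * u) v₀) = Γ (π v v₀) := by
    rw [← inv_mul_cancel_right (v * u) v, map_mul, Module.End.mul_apply, hΓ.2 _ hU, hone, one_mul]
  rw [h2] at h1
  by_contra h3
  exact hψ (mul_right_cancel₀ h3 (by rw [← h1, one_mul]))

lemma whittaker_borel_mul_borel {F : Type} [Field F] [Fintype F] {l : ℕ} (hl : 2 ≤ l) {ρ : F}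
    (hρ : ρ ≠ 0) {ψ : AddChar F ℂ} {V : Type} [AddCommGroup V] [Module ℂ V]
    {π : Representation ℂ (SO2l F l ρ) V} {Γ : V →ₗ[ℂ] ℂ} (hΓ : IsWhittaker F l ρ ψ π Γ)
    {v₀ : V} (hv₀ : IsWhitVec F l ρ ψ π Γ v₀) {w t₁ u₁ t₂ u₂ : SO2l F l ρ}
    (ht₁ : t₁ ∈ TSet F l ρ) (hu₁ : u₁ ∈ USet F l ρ) (hu₂ : u₂ ∈ USet F l ρ)
    (h : Γ (π (t₁ * w * t₂) v₀) = 0) : Γ (π (t₁ * u₁ * w * (t₂ * u₂)) v₀) = 0 := by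
  have h1 : t₁ * u₁ * w * (t₂ * u₂) = t₁ * u₁ * t₁⁻¹ * (t₁ * w * t₂) * u₂ := by group
  rw [h1, map_mul, Module.End.mul_apply, hv₀.2 u₂ hu₂, map_smul, map_smul, map_mul,
    Module.End.mul_apply, hΓ.2 _ (conj_mem_USet hl hρ ht₁ hu₁), h, mul_zero, smul_zero]

lemma torusMat_one_zero_apply {l : ℕ} (hl : 2 ≤ l) {ρ : K} (tv : ℕ → Kˣ) (i : Fin (2*l))
    {j : Fin (2*l)} (hj : midBlk l j = l - 1) :
    torusMat K l ρ tv 1 0 i j = if i = j then 1 else 0 := by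
  by_cases hi : midBlk l i = l - 1
  · have hl0 : l - 1 ≠ l := by omega
    have hl1 : ¬ l < l - 1 := by omega
    have hi' : (i : ℕ) = l - 1 ∨ (i : ℕ) = l := by unfold midBlk at hi; split_ifs at hi <;> omega
    have hj' : (j : ℕ) = l - 1 ∨ (j : ℕ) = l := by unfold midBlk at hj; split_ifs at hj <;> omega
    simp only [torusMat, Matrix.of_apply, Fin.ext_iff]
    rcases hi' with h | h <;> rcases hj' with h' | h' <;> rw [h, h'] <;>
      simp [hl0, hl0.symm, hl1]
  · rw [torusMat_apply_of_ne _ _ _ _ (Or.inl hi), if_neg, if_neg]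
    all_goals
      rintro rfl
      exact hi hj

/-- Conjugation by an element normalizing `T` permutes the coordinates of the split torus. -/
lemma NormalizesT.conj_mem_SSet {l : ℕ} (hl : 2 ≤ l) {ρ : K} (h2 : (2 : K) ≠ 0)
    (hρ : ∀ x : K, x ^ 2 ≠ ρ) {w s : SO2l K l ρ} (hw : NormalizesT K l ρ w)
    {φ : ℕ → ℕ} (hφ : PermutesBlocks l ρ w φ)
    (hφo : ∀ x, IsOuter l x → IsOuter l (φ x)) (hs : s ∈ SSet K l ρ) :
    ∃ tv tv' : ℕ → Kˣ, mat K s = torusMat K l ρ tv 1 0 ∧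
      mat K (w⁻¹ * s * w) = torusMat K l ρ tv' 1 0 ∧
      ∀ x, IsOuter l x → torusDiag l tv' x = torusDiag l tv (φ x) := by
  obtain ⟨tv, htv⟩ := hs
  have hsT : s ∈ TSet K l ρ := ⟨tv, 1, 0, by ring, htv⟩
  obtain ⟨tv', a, b, -, h⟩ := (hw s hsT).2
  have hcol {i j : Fin (2*l)} {c : K} (hc : ∀ m, mat K w m j ≠ 0 →
      ∀ k, mat K s k m = if k = m then c else 0) :
      mat K (w⁻¹ * s * w) i j = if i = j then c else 0 := by
    have h1 (k : Fin (2*l)) : (mat K s * mat K w) k j = c * mat K w k j := by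
      rw [Matrix.mul_apply, Finset.sum_eq_single k]
      · by_cases h3 : mat K w k j = 0
        · rw [h3, mul_zero, mul_zero]
        · rw [hc k h3, if_pos rfl]
      · intro m _ hm
        by_cases h3 : mat K w m j = 0
        · rw [h3, mul_zero]
        · rw [hc m h3, if_neg hm.symm, zero_mul]
      · simp
    rw [mul_assoc, mat_mul, mat_mul, Matrix.mul_apply]
    simp only [h1, mul_left_comm _ c]
    rw [← Finset.mul_sum, ← Matrix.mul_apply, mat_inv_mul_mat, Matrix.one_apply, mul_ite, mul_one,
      mul_zero]
  have hl0 : l - 1 ≠ l := by omega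
  have hmid {i j : Fin (2*l)} (hj : midBlk l j = l - 1) :
      mat K (w⁻¹ * s * w) i j = if i = j then 1 else 0 := by
    apply hcol
    intro m hm k
    have hm' : midBlk l m = l - 1 := by
      by_contra h3
      exact hm (hw.apply_eq_zero hl h2 hρ h3 hj)
    rw [htv, torusMat_one_zero_apply hl tv k hm']
  have ha : a = 1 := by
    have h3 := hmid (i := ⟨l - 1, by omega⟩) (j := ⟨l - 1, by omega⟩) (by simp [midBlk])
    rw [h] at h3
    simpa [torusMat] using h3
  have hb : b = 0 := by
    have h3 := hmid (i := ⟨l, by omega⟩) (j := ⟨l - 1, by omega⟩) (by simp [midBlk])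
    rw [h] at h3
    have h4 : ¬ l < l - 1 := by omega
    simpa [torusMat, h4, hl0.symm] using h3
  subst ha hb
  refine ⟨tv, tv', htv, h, fun x hx => ?_⟩
  have hx' := (isOuter_iff ⟨x, hx.1⟩).mp hx
  have h3 := hcol (i := ⟨x, hx.1⟩) (j := ⟨x, hx.1⟩) (c := torusDiag l tv (φ x)) (by
    intro m hm k
    have hmx := hφ.supp _ _ hm
    rw [hx.midBlk_eq] at hmx
    have hm' : midBlk l m ≠ l - 1 := by
      rw [hmx]
      exact (hφo x hx).2.1
    have hmx' : (m : ℕ) = φ x := by rw [← hmx, ((isOuter_iff m).mpr hm').midBlk_eq]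
    rw [htv, torusMat_apply_of_ne _ _ _ _ (Or.inr hm'), ← hmx']
    split_ifs with h4
    · rw [h4]
    · rfl)
  rw [h, torusMat_apply_of_ne _ _ _ _ (Or.inl hx'), if_pos rfl, if_pos rfl] at h3
  exact h3

/-- The weight of the `x`-th coordinate, as an integral character vector. -/
def coordWeight (l x : ℕ) : ℕ → ℤ := fun i =>
  if x < l - 1 then eVec x i else -eVec (2*l - 1 - x) i

lemma rootEval_eVec {F : Type} [Field F] [Fintype F] {l : ℕ} {ρ : F} {tv : ℕ → Fˣ}
    {s : SO2l F l ρ} (hs : mat F s = torusMat F l ρ tv 1 0) {x : ℕ} (hx : x < l - 1) (n : ℤ) :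
    rootEval F l ρ (fun i => n * eVec x i) s = (tv x : F) ^ n := by
  rw [rootEval, Finset.prod_eq_single ⟨x, by omega⟩]
  · rw [if_pos hx, hs]
    simp [torusMat, hx, eVec]
  · intro i _ hi
    have hi' : (i : ℕ) ≠ x := fun h => hi (Fin.ext h)
    simp [eVec, hi']
  · simp

lemma rootEval_add {F : Type} [Field F] [Fintype F] {l : ℕ} {ρ : F} {tv : ℕ → Fˣ}
    {s : SO2l F l ρ} (hs : mat F s = torusMat F l ρ tv 1 0) (α β : ℕ → ℤ) :
    rootEval F l ρ (fun i => α i + β i) s = rootEval F l ρ α s * rootEval F l ρ β s := by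
  rw [rootEval, rootEval, rootEval, ← Finset.prod_mul_distrib]
  apply Finset.prod_congr rfl
  intro i _
  split_ifs with h
  · rw [zpow_add₀]
    rw [hs]
    simp [torusMat, h]
  · rw [one_mul]

lemma rootEval_coordWeight {F : Type} [Field F] [Fintype F] {l : ℕ} {ρ : F} {tv : ℕ → Fˣ}
    {s : SO2l F l ρ} (hs : mat F s = torusMat F l ρ tv 1 0) {x : ℕ} (hx : IsOuter l x) (n : ℤ) :
    rootEval F l ρ (fun i => n * coordWeight l x i) s = torusDiag l tv x ^ n := by
  unfold IsOuter at hx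
  by_cases h : x < l - 1
  · simp only [coordWeight, if_pos h]
    rw [rootEval_eVec hs h, torusDiag, if_pos h]
  · simp only [coordWeight, if_neg h, mul_neg, ← neg_mul]
    rw [rootEval_eVec hs (by omega), torusDiag, if_neg h]
    simp

lemma NormalizesT.mapsRoot_coordWeight {F : Type} [Field F] [Fintype F] {l : ℕ} (hl : 2 ≤ l)
    {ρ : F} (h2 : (2 : F) ≠ 0) (hρ : ∀ x : F, x ^ 2 ≠ ρ) {w : SO2l F l ρ}
    (hw : NormalizesT F l ρ w) {φ : ℕ → ℕ} (hφ : PermutesBlocks l ρ w φ)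
    (hφo : ∀ x, IsOuter l x → IsOuter l (φ x)) {x y : ℕ} (hx : IsOuter l x) (hy : IsOuter l y)
    (m n : ℤ) :
    mapsRoot F l ρ w (fun i => m * coordWeight l x i + n * coordWeight l y i)
      (fun i => m * coordWeight l (φ x) i + n * coordWeight l (φ y) i) := by
  intro s hs
  obtain ⟨tv, tv', h, h', htv⟩ := hw.conj_mem_SSet hl h2 hρ hφ hφo hs
  refine ⟨⟨tv', h'⟩, ?_⟩
  rw [rootEval_add h, rootEval_add h', rootEval_coordWeight h (hφo x hx),
    rootEval_coordWeight h (hφo y hy), rootEval_coordWeight h' hx, rootEval_coordWeight h' hy,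
    htv x hx, htv y hy]

lemma coordWeight_sub_mem {l a b : ℕ} (ha : IsOuter l a) (hb : IsOuter l b) (hab : a ≠ b)
    (hab' : a + b ≠ 2*l - 1) (h : b < a ∨ b = a + 1) :
    (fun i => 1 * coordWeight l a i + (-1) * coordWeight l b i) ∈ negRoot l ∨
      isSimpleRoot l (fun i => 1 * coordWeight l a i + (-1) * coordWeight l b i) := by
  unfold IsOuter at ha hb
  rcases h with h | h
  · left
    by_cases ha' : a < l - 1
    · refine Or.inl ⟨b, a, h, ha', ?_⟩
      funext i
      simp only [coordWeight, if_pos ha', if_pos (h.trans ha')]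
      ring
    · by_cases hb' : b < l - 1
      · rcases Nat.lt_or_ge b (2*l - 1 - a) with h3 | h3
        · refine Or.inr (Or.inl ⟨b, 2*l - 1 - a, h3, by omega, ?_⟩)
          funext i
          simp only [coordWeight, if_neg ha', if_pos hb']
          ring
        · refine Or.inr (Or.inl ⟨2*l - 1 - a, b, by omega, by omega, ?_⟩)
          funext i
          simp only [coordWeight, if_neg ha', if_pos hb']
          ring
      · refine Or.inl ⟨2*l - 1 - a, 2*l - 1 - b, by omega, by omega, ?_⟩
        funext i
        simp only [coordWeight, if_neg ha', if_neg hb']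
        ring
  · right
    subst h
    by_cases ha' : a < l - 1
    · refine ⟨a, ha', ?_⟩
      funext i
      have h1 : a + 1 < l - 1 := by omega
      have h3 : a + 3 ≤ l := by omega
      simp only [coordWeight, if_pos ha', if_pos h1, simpleRoot, eVec, h3, and_true]
      ring
    · refine ⟨2*l - 1 - (a + 1), by omega, ?_⟩
      funext i
      have h1 : ¬ a + 1 < l - 1 := by omega
      have h3 : 2*l - 1 - (a + 1) + 3 ≤ l := by omega
      have h4 : 2*l - 1 - (a + 1) + 1 = 2*l - 1 - a := by omega
      simp only [coordWeight, if_neg ha', if_neg h1, simpleRoot, eVec, h3, h4, and_true]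
      ring

lemma coordWeight_mem {l a b : ℕ} (ha : IsOuter l a) (h : l - 2 ≤ a) :
    (fun i => 1 * coordWeight l a i + 0 * coordWeight l b i) ∈ negRoot l ∨
      isSimpleRoot l (fun i => 1 * coordWeight l a i + 0 * coordWeight l b i) := by
  unfold IsOuter at ha
  by_cases ha' : a < l - 1
  · refine Or.inr ⟨a, ha', ?_⟩
    funext i
    have h3 : ¬ a + 3 ≤ l := by omega
    simp [coordWeight, ha', simpleRoot, eVec, h3]
  · refine Or.inl (Or.inr (Or.inr ⟨2*l - 1 - a, by omega, ?_⟩))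
    funext i
    simp [coordWeight, ha']

end

theorem bessel_vanishes_off_support
    (F : Type) [Field F] [Fintype F] (p r : ℕ) (hp : p.Prime) (hp2 : p ≠ 2)
    (hr : 0 < r) (hcard : Fintype.card F = p ^ r)
    (ψ : AddChar F ℂ) (hψ : ψ ≠ 1)
    (l : ℕ) (hl : 2 ≤ l) (ρ : F) (hρ : ∀ x : F, x ^ 2 ≠ ρ)
    (V : Type) [AddCommGroup V] [Module ℂ V]
    (π : Representation ℂ (SO2l F l ρ) V)
    (hπirr : IsIrrep π)
    (Γ : V →ₗ[ℂ] ℂ) (hΓ : IsWhittaker F l ρ ψ π Γ)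
    (v₀ : V) (hv₀ : IsWhitVec F l ρ ψ π Γ v₀)
    (w : SO2l F l ρ) (hwN : NormalizesT F l ρ w) (hwB : ¬ SupportsBessel F l ρ w)
    (g : SO2l F l ρ)
    (hg : ∃ b₁ ∈ BorelSet F l ρ, ∃ b₂ ∈ BorelSet F l ρ, g = b₁ * w * b₂) :
    Bessel F l ρ π Γ v₀ g = 0 := by
  have hρ0 : ρ ≠ 0 := fun h => hρ 0 (by rw [h]; simp)
  have h2 : (2 : F) ≠ 0 := by
    refine Ring.two_ne_zero fun h => ?_
    have h1 := FiniteField.even_card_iff_char_two.mp h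
    rw [hcard, ← Nat.even_iff] at h1
    exact hp2 ((Nat.Prime.even_iff hp).mp (Nat.even_pow.mp h1).1)
  obtain ⟨x, hx⟩ := AddChar.ne_one_iff.mp hψ
  obtain ⟨b₁, ⟨t₁, ht₁, u₁, hu₁, rfl⟩, b₂, ⟨t₂, ht₂, u₂, hu₂, rfl⟩, rfl⟩ := hg
  obtain ⟨φ, hφ, hφm, hφo, hφi⟩ := hwN.exists_permutesBlocks hl h2 hρ
  have hv : PermutesBlocks l ρ (t₁ * w * t₂) φ :=
    ((permutesBlocks_of_mem_TSet hl hρ0 ht₁).mul hφ).mul (permutesBlocks_of_mem_TSet hl hρ0 ht₂)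
  rw [Bessel, whittaker_borel_mul_borel hl hρ0 hΓ hv₀ ht₁ hu₁ hu₂, zero_div]
  by_contra hne
  refine hwB fun k hk => ?_
  have hmaps {x y : ℕ} (hx : IsOuter l x) (hy : IsOuter l y) (m n : ℤ) :=
    hwN.mapsRoot_coordWeight hl h2 hρ hφ (fun x hx => (hφo x hx).1) hx hy m n
  have hko : IsOuter l k := ⟨by omega, by omega, by omega⟩
  have hφk := hφo k hko
  by_cases hk3 : k + 3 ≤ l
  · have hko' : IsOuter l (k + 1) := ⟨by omega, by omega, by omega⟩
    have hφk' := hφo (k + 1) hko'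
    have hstar : IsOuter l (2*l - 1 - k) := ⟨by omega, by omega, by omega⟩
    have hroot : simpleRoot l k =
        fun i => 1 * coordWeight l k i + (-1) * coordWeight l (k + 1) i := by
      funext i
      have h1 : k + 1 < l - 1 := by omega
      simp only [simpleRoot, coordWeight, eVec, if_pos hk, if_pos h1, hk3, and_true]
      ring
    rw [hroot]
    refine ⟨_, hmaps hko hko' 1 (-1), coordWeight_sub_mem hφk.1 hφk'.1 ?_ ?_ ?_⟩
    · intro h
      have := hφi _ _ hko hko' h
      omega
    · intro h
      have h1 : φ (2*l - 1 - k) = φ (k + 1) := by rw [hφk.2]; omega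
      have := hφi _ _ hstar hko' h1
      omega
    · by_contra! h
      have hlt : φ k < φ (k + 1) := by
        refine lt_of_le_of_ne h.1 fun h3 => ?_
        have := hφi _ _ hko hko' h3
        omega
      obtain ⟨u, hu, hψu, hsupp⟩ := exists_unip_long hk3 ρ ψ x
      refine hne (whittaker_apply_eq_zero hl hΓ hv₀ hv hu (by rwa [hψu]) fun a b hab => ?_)
      have h3 : 2*l - 2 - k = 2*l - 1 - (k + 1) := by omega
      have h4 := hφk.1.1
      have h5 := hφk'.1.1
      rcases hsupp a b hab with ⟨ha, hb⟩ | ⟨ha, hb⟩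
      · rw [ha, hb]
        exact ⟨hlt, fun h6 => h.2 h6.1⟩
      · rw [ha, hb, h3, hφk.2, hφk'.2]
        omega
  · obtain rfl : k = l - 2 := by omega
    have hroot : simpleRoot l (l - 2) =
        fun i => 1 * coordWeight l (l - 2) i + 0 * coordWeight l (l - 2) i := by
      funext i
      simp [simpleRoot, coordWeight, eVec, hk, hk3]
    rw [hroot]
    refine ⟨_, hmaps hko hko 1 0, coordWeight_mem hφk.1 ?_⟩
    by_contra! h
    obtain ⟨u, hu, hψu, hsupp⟩ := exists_unip_short hl h2 hρ0 ψ x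
    refine hne (whittaker_apply_eq_zero hl hΓ hv₀ hv hu (by rwa [hψu]) fun a b hab => ?_)
    have h3 : l + 1 = 2*l - 1 - (l - 2) := by omega
    rcases hsupp a b hab with ⟨ha, hb⟩ | ⟨ha, hb⟩ | ⟨ha, hb⟩
    · rw [ha, hb, hφm]
      omega
    · rw [ha, hb, hφm, h3, hφk.2]
      omega
    · rw [ha, hb, h3, hφk.2]
      omega

end ConverseSO
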